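/- arXiv:2305.11587 — 5 statements merged into one kernel-verified Lean document; each statement's English description precedes it below -/
import Mathlib

section
/- Let 0 < δ ≤ Δ ≤ 1 and 0 < σ ≤ Σ ≤ 1 be dyadic numbers with Δ ≤ Σ. Assume p ∈ 𝒟_δ and 𝐩 ∈ 𝒟_Δ with p ⊂ 𝐩, and let v ∈ 𝒮_σ(p). If 𝐯 ∈ 𝒮_Σ(𝐩) is such that v ∩ V(𝐩,𝐯) ≠ ∅, then there exists an arc I_𝐯 ⊂ S(𝐩) of length at most KΣ, where K is an absolute constant, such that v ⊂ V(𝐩,I_𝐯) and 𝐯 ⊂ I_𝐯. -/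
open Metric Set

noncomputable section

/-- The plane `ℝ²`. -/
abbrev Plane := EuclideanSpace ℝ (Fin 2)

/-- The parameter space `ℝ² × ℝ` of circles: a pair `(x, r)` of a centre and a radius. -/
abbrev Param := (EuclideanSpace ℝ (Fin 2)) × ℝ

/-- The point of `ℝ²` with coordinates `a`, `b`. -/
def mk2 (a b : ℝ) : Plane := (WithLp.equiv 2 (Fin 2 → ℝ)).symm ![a, b]

/-- The Euclidean distance on `ℝ² × ℝ`, viewed as `ℝ³`. -/
def pdist (p q : Param) : ℝ := Real.sqrt (dist p.1 q.1 ^ 2 + (p.2 - q.2) ^ 2)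

/-- The tangency parameter `Δ(p,q) = ||x - x'| - |r - r'||`. -/
def tang (p q : Param) : ℝ := abs (dist p.1 q.1 - |p.2 - q.2|)

/-- The domain `𝐃 = {(x,r) : |x| ≤ 1/4, r ∈ [1/2, 1]}`. -/
def domD : Set Param := {p | ‖p.1‖ ≤ 1 / 4 ∧ p.2 ∈ Set.Icc (1 / 2 : ℝ) 1}

/-- The circle `S(p)` with centre `p.1` and radius `p.2`. -/
def circ (p : Param) : Set Plane := Metric.sphere p.1 p.2

/-- The closed `δ`-annulus `S^δ(p)` around the circle `S(p)`. -/
def annulus (δ : ℝ) (p : Param) : Set Plane := {w | Metric.infDist w (circ p) ≤ δ}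

/-- The `(δ,σ)`-rectangle `R^δ_σ(p,v) = S^δ(p) ∩ B(v,σ)`. -/
def rect (δ σ : ℝ) (p : Param) (v : Plane) : Set Plane :=
  annulus δ p ∩ Metric.closedBall v σ

/-- Admissible data `(p, v)` for a rectangle: `p ∈ 𝐃` and `v ∈ S(p)`. -/
def IsRectData (r : Param × Plane) : Prop := r.1 ∈ domD ∧ r.2 ∈ circ r.1

/-- `C`-comparability of two rectangles (given by their data): there is a third
`(δ,σ)`-rectangle `R` with `R₁ ∪ R₂ ⊆ C·R`. -/
def Comp (δ σ C : ℝ) (r₁ r₂ : Param × Plane) : Prop :=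
  ∃ r : Param × Plane, IsRectData r ∧
    rect δ σ r₁.1 r₁.2 ∪ rect δ σ r₂.1 r₂.2 ⊆ rect (C * δ) (C * σ) r.1 r.2

/-- The index of the dyadic `δ`-cube of `ℝ²` containing a point. -/
def idx2 (δ : ℝ) (v : Plane) : ℤ × ℤ := (⌊v 0 / δ⌋, ⌊v 1 / δ⌋)

/-- The index of the dyadic `δ`-cube of `ℝ³ = ℝ² × ℝ` containing a point. -/
def idx3 (δ : ℝ) (p : Param) : (ℤ × ℤ) × ℤ := (idx2 δ p.1, ⌊p.2 / δ⌋)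

/-- `|E|_δ`: the number of dyadic `δ`-cubes intersecting `E ⊆ ℝ²`. -/
def count2 (δ : ℝ) (E : Set Plane) : ℕ := Nat.card (idx2 δ '' E)

/-- `|P|_δ`: the number of dyadic `δ`-cubes intersecting `P ⊆ ℝ³`. -/
def count3 (δ : ℝ) (P : Set Param) : ℕ := Nat.card (idx3 δ '' P)

/-- `|Ω|_δ`: the number of dyadic `δ`-cubes of `ℝ⁵ = ℝ³ × ℝ²` intersecting `Ω`. -/
def count5 (δ : ℝ) (Ω : Set (Param × Plane)) : ℕ :=
  Nat.card ((fun ω => (idx3 δ ω.1, idx2 δ ω.2)) '' Ω)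

/-- A `(δ,s,C)`-set in the plane. -/
def IsDSet2 (δ s C : ℝ) (E : Set Plane) : Prop :=
  Bornology.IsBounded E ∧ ∀ (x : Plane) (r : ℝ), δ ≤ r →
    (count2 δ (E ∩ Metric.closedBall x r) : ℝ) ≤ C * r ^ s * (count2 δ E : ℝ)

/-- A `(δ,s,C)`-set in `ℝ³ = ℝ² × ℝ`. -/
def IsDSet3 (δ s C : ℝ) (P : Set Param) : Prop :=
  Bornology.IsBounded P ∧ ∀ (x : Param) (r : ℝ), δ ≤ r →
    (count3 δ (P ∩ {q | pdist q x ≤ r}) : ℝ) ≤ C * r ^ s * (count3 δ P : ℝ)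

/-- `x ∈ 2^{-ℕ}`. -/
def IsDyadic (x : ℝ) : Prop := ∃ n : ℕ, x = (2 : ℝ) ^ (-(n : ℤ))

/-- The smallest dyadic rational `2^{-n} ≥ σ` (for `σ ∈ (0,1]`). -/
def dyadicCeil (σ : ℝ) : ℝ := (2 : ℝ) ^ (-⌊Real.logb 2 σ⁻¹⌋)

/-- Indices of dyadic cubes in `ℝ³ = ℝ² × ℝ`. -/
abbrev CubeIdx := (ℤ × ℤ) × ℤ

/-- The dyadic cube of side length `δ` with index `k`. -/
def cubeSet (δ : ℝ) (k : CubeIdx) : Set Param :=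
  {p | (k.1.1 : ℝ) * δ ≤ p.1 0 ∧ p.1 0 < ((k.1.1 : ℝ) + 1) * δ ∧
       (k.1.2 : ℝ) * δ ≤ p.1 1 ∧ p.1 1 < ((k.1.2 : ℝ) + 1) * δ ∧
       (k.2 : ℝ) * δ ≤ p.2 ∧ p.2 < ((k.2 : ℝ) + 1) * δ}

/-- The centre of the dyadic cube of side length `δ` with index `k`. -/
def cubeCtr (δ : ℝ) (k : CubeIdx) : Param :=
  (mk2 (((k.1.1 : ℝ) + 1 / 2) * δ) (((k.1.2 : ℝ) + 1 / 2) * δ), ((k.2 : ℝ) + 1 / 2) * δ)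

/-- The unit vector with angle `θ`. -/
def dir (θ : ℝ) : Plane := mk2 (Real.cos θ) (Real.sin θ)

/-- The `j`-th (half-open) arc of the partition `𝒮_σ(p)` of the circle `S(p)`
into arcs of length `2πrσ`. -/
def arcSet (p : Param) (σ : ℝ) (j : ℤ) : Set Plane :=
  {w | ∃ θ : ℝ, (j : ℝ) * (2 * Real.pi * σ) ≤ θ ∧ θ < ((j : ℝ) + 1) * (2 * Real.pi * σ) ∧
    w = p.1 + p.2 • dir θ}

/-- The centre of the `j`-th arc of `𝒮_σ(p)`. -/
def arcCenterAt (p : Param) (σ : ℝ) (j : ℤ) : Plane :=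
  p.1 + p.2 • dir (((j : ℝ) + 1 / 2) * (2 * Real.pi * σ))

/-- Valid indices for the arcs of `𝒮_σ(p)`. -/
def validArc (σ : ℝ) (j : ℤ) : Prop := 0 ≤ j ∧ (j : ℝ) < σ⁻¹

/-- The (one-sided) cone `V(p, I)` centred at the centre of `p` and spanned by `I`. -/
def cone (p : Param) (I : Set Plane) : Set Plane :=
  {x | ∃ e ∈ I, ∃ t : ℝ, 0 ≤ t ∧ x = p.1 + t • (e - p.1)}

/-- A pair: (index of a dyadic cube in `ℝ³`, index of an arc). -/
abbrev DPair := CubeIdx × ℤ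

/-- The relation `(p,v) ≺ (𝐩,𝐯)` between pairs at scales `(δ,σ)` and `(Δ,Σ)`. -/
def prec (δ σ Δ Sg : ℝ) (ω W : DPair) : Prop :=
  cubeSet δ ω.1 ⊆ cubeSet Δ W.1 ∧
  arcCenterAt (cubeCtr δ ω.1) σ ω.2 ∈ cone (cubeCtr Δ W.1) (arcSet (cubeCtr Δ W.1) Sg W.2)

/-- The `(Δ,Σ)`-skeleton `Ω^Δ_Σ` of a set of pairs at scales `(δ,σ)`. -/
def skeleton (δ σ Δ Sg : ℝ) (Ω : Set DPair) : Set DPair :=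
  {W | cubeSet Δ W.1 ⊆ domD ∧ validArc Sg W.2 ∧ ∃ ω ∈ Ω, prec δ σ Δ Sg ω W}

/-- The cube family `P` of a configuration. -/
def configP (Ω : Set DPair) : Set CubeIdx := Prod.fst '' Ω

/-- The arc family `E_σ(p)` of a configuration. -/
def configE (Ω : Set DPair) (k : CubeIdx) : Set ℤ := {j | (k, j) ∈ Ω}

/-- A (dyadic) `(δ,σ,s,C,M)`-configuration. -/
def IsConfigD (δ σ s C : ℝ) (M : ℕ) (Ω : Set DPair) : Prop :=
  (configP Ω).Nonempty ∧
  (∀ k ∈ configP Ω, cubeSet δ k ⊆ domD) ∧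
  IsDSet3 δ s C (⋃ k ∈ configP Ω, cubeSet δ k) ∧
  ∀ k ∈ configP Ω,
    (∀ j ∈ configE Ω k, validArc σ j) ∧
    IsDSet2 σ s C (⋃ j ∈ configE Ω k, arcSet (cubeCtr δ k) σ j) ∧
    Nat.card (configE Ω k) = M

/-- The partial multiplicity function `m^{ρ_λ,ρ_t,C}_{Δ,λ,t}(ω ∣ G)`, counting pairs in the
`(Δ, σa)`-skeleton of `G`; the geometric data of `ω` is given by the circle parameter `pω`
(the centre of the cube of `ω`) and the arc centre `vω`. -/
def pMult (baseδ baseσ Δ σa lam t ρl ρt C : ℝ) (G : Set DPair) (pω : Param) (vω : Plane) : ℕ :=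
  Nat.card {ω' : DPair | ω' ∈ skeleton baseδ baseσ Δ σa G ∧
    (lam ≤ ρl * Δ ∨ lam / ρl ≤ tang pω (cubeCtr Δ ω'.1)) ∧
    tang pω (cubeCtr Δ ω'.1) ≤ ρl * lam ∧
    t / ρt ≤ pdist pω (cubeCtr Δ ω'.1) ∧
    pdist pω (cubeCtr Δ ω'.1) ≤ ρt * t ∧
    (rect (C * Δ) (C * σa) pω vω ∩
      rect (C * Δ) (C * σa) (cubeCtr Δ ω'.1) (arcCenterAt (cubeCtr Δ ω'.1) σa ω'.2)).Nonempty}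

/-- A `δ`-separated set in `ℝ³ = ℝ² × ℝ`. -/
def sep3 (δ : ℝ) (A : Set Param) : Prop := ∀ p ∈ A, ∀ q ∈ A, p ≠ q → δ ≤ pdist p q

/-- A `(δ,ε)`-almost `t`-bipartite pair. -/
def AlmostBipartite (δ ε t : ℝ) (W B : Set Param) : Prop :=
  sep3 δ W ∧ sep3 δ B ∧ (∀ p ∈ W, ∀ q ∈ B, δ ^ ε * t ≤ pdist p q) ∧
    ∀ p ∈ W ∪ B, ∀ q ∈ W ∪ B, pdist p q ≤ δ ^ (-ε) * t

/-- A `t`-bipartite pair (relative to the scale `δ`). -/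
def Bipartite (δ t : ℝ) (W B : Set Param) : Prop :=
  sep3 δ W ∧ sep3 δ B ∧
  (∀ p ∈ W, ∀ q ∈ W, pdist p q ≤ t) ∧ (∀ p ∈ B, ∀ q ∈ B, pdist p q ≤ t) ∧
  (∀ p ∈ B, ∀ q ∈ W, t ≤ pdist p q) ∧
  ∀ p ∈ W ∪ B, ∀ q ∈ W ∪ B, pdist p q ≤ 100 * t

/-- The arc `{x + r·(cos θ, sin θ) : θ ∈ [a,b]}` of the circle with parameter `p`. -/
def genArc (p : Param) (a b : ℝ) : Set Plane :=
  {w | ∃ θ : ℝ, a ≤ θ ∧ θ ≤ b ∧ w = p.1 + p.2 • dir θ}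

theorem core_aux (d0 d1 r θ : ℝ) (hd : d0 ^ 2 + d1 ^ 2 ≤ 4 / 25) (hr : 1 / 2 ≤ r) :
    1 / 100 ≤ (d0 + r * Real.cos θ) ^ 2 + (d1 + r * Real.sin θ) ^ 2 := by
  have h1 := Real.sin_sq_add_cos_sq θ
  set c := Real.cos θ
  set s := Real.sin θ
  have h2 : (d0 * c + d1 * s) ^ 2 ≤ (2 / 5) ^ 2 := by
    have : (d0 * c + d1 * s) ^ 2 + (d0 * s - d1 * c) ^ 2 = (d0 ^ 2 + d1 ^ 2) * (s ^ 2 + c ^ 2) := by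
      ring
    rw [h1] at this
    nlinarith [sq_nonneg (d0 * s - d1 * c)]
  have h3 := abs_le_of_sq_le_sq' h2 (by norm_num)
  have h4 : (d0 + r * c) ^ 2 + (d1 + r * s) ^ 2
      = (d0 * c + d1 * s + r) ^ 2 + (d0 * s - d1 * c) ^ 2
        + (1 - (s ^ 2 + c ^ 2)) * (d0 ^ 2 + d1 ^ 2 - r ^ 2) := by
    ring
  rw [h4, h1]
  nlinarith [sq_nonneg (d0 * s - d1 * c), h3.1]

theorem polar_aux (A B θ0 : ℝ) : ∃ ρ α : ℝ, 0 ≤ ρ ∧ |α| ≤ Real.pi ∧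
    A = ρ * Real.cos (θ0 + α) ∧ B = ρ * Real.sin (θ0 + α) := by
  let z : ℂ := ⟨A * Real.cos θ0 + B * Real.sin θ0, B * Real.cos θ0 - A * Real.sin θ0⟩
  refine ⟨‖z‖, Complex.arg z, norm_nonneg _, Complex.abs_arg_le_pi z, ?_, ?_⟩
  · have h1 : ‖z‖ * Real.cos (Complex.arg z) = A * Real.cos θ0 + B * Real.sin θ0 :=
      Complex.norm_mul_cos_arg z
    have h2 : ‖z‖ * Real.sin (Complex.arg z) = B * Real.cos θ0 - A * Real.sin θ0 :=
      Complex.norm_mul_sin_arg z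
    rw [Real.cos_add]
    linear_combination (-Real.cos θ0) * h1 + Real.sin θ0 * h2 - A * Real.sin_sq_add_cos_sq θ0
  · have h1 : ‖z‖ * Real.cos (Complex.arg z) = A * Real.cos θ0 + B * Real.sin θ0 :=
      Complex.norm_mul_cos_arg z
    have h2 : ‖z‖ * Real.sin (Complex.arg z) = B * Real.cos θ0 - A * Real.sin θ0 :=
      Complex.norm_mul_sin_arg z
    rw [Real.sin_add]
    linear_combination (-Real.sin θ0) * h1 - Real.cos θ0 * h2 - B * Real.sin_sq_add_cos_sq θ0

theorem core (d0 d1 r θ θ' θ0 ρ0 s : ℝ) (hd : d0 ^ 2 + d1 ^ 2 ≤ 4 / 25) (hr : 1 / 2 ≤ r)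
    (hr1 : r ≤ 1) (hρ0 : 0 ≤ ρ0)
    (e0 : d0 + r * Real.cos θ' = ρ0 * Real.cos θ0)
    (e1 : d1 + r * Real.sin θ' = ρ0 * Real.sin θ0) (hs : |θ - θ'| ≤ s) :
    ∃ ρ α : ℝ, 0 ≤ ρ ∧ |α| ≤ 5 * Real.pi * s ∧
      d0 + r * Real.cos θ = ρ * Real.cos (θ0 + α) ∧
      d1 + r * Real.sin θ = ρ * Real.sin (θ0 + α) := by
  obtain ⟨ρ, α, hρ, hα, f0, f1⟩ := polar_aux (d0 + r * Real.cos θ) (d1 + r * Real.sin θ) θ0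
  refine ⟨ρ, α, hρ, ?_, f0, f1⟩
  have hs0 : 0 ≤ s := (abs_nonneg _).trans hs
  have a1 := core_aux d0 d1 r θ hd hr
  have a2 := core_aux d0 d1 r θ' hd hr
  have hρ' : 1 / 10 ≤ ρ := by
    rw [f0, f1] at a1
    have : ρ ^ 2 = (ρ * Real.cos (θ0 + α)) ^ 2 + (ρ * Real.sin (θ0 + α)) ^ 2 := by
      linear_combination (-ρ ^ 2) * Real.sin_sq_add_cos_sq (θ0 + α)
    nlinarith
  have hρ0' : 1 / 10 ≤ ρ0 := by
    rw [e0, e1] at a2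
    have : ρ0 ^ 2 = (ρ0 * Real.cos θ0) ^ 2 + (ρ0 * Real.sin θ0) ^ 2 := by
      linear_combination (-ρ0 ^ 2) * Real.sin_sq_add_cos_sq θ0
    nlinarith
  have k1 : r ^ 2 * (2 - 2 * Real.cos (θ - θ')) = (ρ - ρ0) ^ 2 + 2 * (ρ * ρ0) * (1 - Real.cos α) := by
    have g0 : r * (Real.cos θ - Real.cos θ') = ρ * Real.cos (θ0 + α) - ρ0 * Real.cos θ0 := by
      linarith
    have g1 : r * (Real.sin θ - Real.sin θ') = ρ * Real.sin (θ0 + α) - ρ0 * Real.sin θ0 := by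
      linarith
    have hα' : Real.cos α = Real.cos (θ0 + α) * Real.cos θ0 + Real.sin (θ0 + α) * Real.sin θ0 := by
      rw [← Real.cos_sub]; congr 1; ring
    have q0 := congrArg (· ^ 2) g0
    have q1 := congrArg (· ^ 2) g1
    rw [hα', Real.cos_sub]
    linear_combination q0 + q1 - r ^ 2 * Real.sin_sq_add_cos_sq θ - r ^ 2 * Real.sin_sq_add_cos_sq θ'
      + ρ ^ 2 * Real.sin_sq_add_cos_sq (θ0 + α) + ρ0 ^ 2 * Real.sin_sq_add_cos_sq θ0
  have k2 := Real.one_sub_sq_div_two_le_cos (x := θ - θ')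
  have k3 : (θ - θ') ^ 2 ≤ s ^ 2 := sq_le_sq' (abs_le.1 hs).1 (abs_le.1 hs).2
  have k4 : r ^ 2 * (2 - 2 * Real.cos (θ - θ')) ≤ s ^ 2 := by
    have : r ^ 2 ≤ 1 := by nlinarith
    have h0 : 0 ≤ 2 - 2 * Real.cos (θ - θ') := by linarith [Real.cos_le_one (θ - θ')]
    calc _ ≤ 1 * (2 - 2 * Real.cos (θ - θ')) := mul_le_mul_of_nonneg_right this h0
      _ ≤ _ := by linarith
  have k5 := Real.cos_le_one_sub_mul_cos_sq hα
  have k6 : 1 / 100 ≤ ρ * ρ0 := by nlinarith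
  have k7 : 1 / 50 * (1 - Real.cos α) ≤ s ^ 2 := by
    have := mul_le_mul_of_nonneg_right k6 (sub_nonneg.2 (Real.cos_le_one α))
    linarith [sq_nonneg (ρ - ρ0)]
  have k8 : α ^ 2 ≤ (5 * Real.pi * s) ^ 2 := by
    have hp := Real.pi_pos
    have : 2 / Real.pi ^ 2 * α ^ 2 ≤ 50 * s ^ 2 := by linarith
    rw [div_mul_eq_mul_div, div_le_iff₀ (by positivity)] at this
    linarith
  exact abs_le_of_sq_le_sq k8 (by have := Real.pi_pos; positivity)

theorem ctr_mem (δ : ℝ) (hδ : 0 < δ) (k : CubeIdx) : cubeCtr δ k ∈ cubeSet δ k := by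
  simp only [cubeCtr, cubeSet, mk2, Set.mem_ofPred_eq]
  refine ⟨?_, ?_, ?_, ?_, ?_, ?_⟩ <;> simp <;> nlinarith

/-- if `p ∈ 𝒟_δ`, `𝐩 ∈ 𝒟_Δ` with `p ⊆ 𝐩`, `v ∈ 𝒮_σ(p)`,
`𝐯 ∈ 𝒮_Σ(𝐩)` and `v ∩ V(𝐩,𝐯) ≠ ∅`, then there is an arc `I ⊆ S(𝐩)` of length at
most `KΣ` with `v ⊆ V(𝐩,I)` and `𝐯 ⊆ I`. -/
theorem cone_arc_lemma :
    ∃ K > (0 : ℝ),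
    ∀ δ Δ σ Sg : ℝ, IsDyadic δ → IsDyadic Δ → IsDyadic σ → IsDyadic Sg →
      0 < δ → δ ≤ Δ → Δ ≤ 1 → 0 < σ → σ ≤ Sg → Sg ≤ 1 → Δ ≤ Sg →
    ∀ k kk : CubeIdx, cubeSet δ k ⊆ domD → cubeSet Δ kk ⊆ domD →
      cubeSet δ k ⊆ cubeSet Δ kk →
    ∀ j : ℤ, validArc σ j → ∀ J : ℤ, validArc Sg J →
    (arcSet (cubeCtr δ k) σ j ∩ cone (cubeCtr Δ kk) (arcSet (cubeCtr Δ kk) Sg J)).Nonempty →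
    ∃ a b : ℝ, a ≤ b ∧ (cubeCtr Δ kk).2 * (b - a) ≤ K * Sg ∧
      arcSet (cubeCtr δ k) σ j ⊆ cone (cubeCtr Δ kk) (genArc (cubeCtr Δ kk) a b) ∧
      arcSet (cubeCtr Δ kk) Sg J ⊆ genArc (cubeCtr Δ kk) a b := by
  have hp := Real.pi_pos
  refine ⟨2 * Real.pi + 20 * Real.pi ^ 2, by positivity, ?_⟩
  intro δ Δ σ Sg _ _ _ _ hδ hδΔ _ hσ hσS _ hΔS k kk hk hkk hkkk j _ J _ hne
  have hΔ : 0 < Δ := hδ.trans_le hδΔ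
  have hm := ctr_mem δ hδ k
  have hSg : 0 < Sg := hσ.trans_le hσS
  have hM := ctr_mem Δ hΔ kk
  have hmM := hkkk hm
  have hmD := hk hm
  have hMD := hkk hM
  -- size of the big cube
  have hΔ' : Δ ≤ 5 / 9 := by
    have h1 : ((cubeCtr Δ kk).1, (kk.2 : ℝ) * Δ) ∈ cubeSet Δ kk := by
      obtain ⟨m1, m2, m3, m4, m5, m6⟩ := hM
      exact ⟨m1, m2, m3, m4, le_refl _, by simp only; nlinarith⟩
    have h2 : ((cubeCtr Δ kk).1, ((kk.2 : ℝ) + 9 / 10) * Δ) ∈ cubeSet Δ kk := by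
      obtain ⟨m1, m2, m3, m4, m5, m6⟩ := hM
      exact ⟨m1, m2, m3, m4, by simp only; nlinarith, by simp only; nlinarith⟩
    have h3 := (hkk h1).2.1
    have h4 := (hkk h2).2.2
    simp only at h3 h4
    nlinarith
  have hP0 : (cubeCtr Δ kk).1 0 = ((kk.1.1 : ℝ) + 1 / 2) * Δ := by simp [cubeCtr, mk2]
  have hP1 : (cubeCtr Δ kk).1 1 = ((kk.1.2 : ℝ) + 1 / 2) * Δ := by simp [cubeCtr, mk2]
  generalize cubeCtr δ k = p at *
  generalize cubeCtr Δ kk = P at *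
  obtain ⟨m1, m2, m3, m4, -, -⟩ := hmM
  obtain ⟨-, hr, hr1⟩ := hmD
  obtain ⟨-, hR, hR1⟩ := hMD
  have hRpos : 0 < P.2 := by linarith
  have hd : (p.1 0 - P.1 0) ^ 2 + (p.1 1 - P.1 1) ^ 2 ≤ 4 / 25 := by
    have b0 : (p.1 0 - P.1 0) ^ 2 ≤ (5 / 18) ^ 2 := sq_le_sq' (by linarith) (by linarith)
    have b1 : (p.1 1 - P.1 1) ^ 2 ≤ (5 / 18) ^ 2 := sq_le_sq' (by linarith) (by linarith)
    linarith
  obtain ⟨w0, ⟨θ', hθ1, hθ2, hw0⟩, e, ⟨θ0, hJ1, hJ2, rfl⟩, t, ht, hw0'⟩ := hne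
  have hd0 : ∀ x : ℝ, (dir x) 0 = Real.cos x := fun x => by simp [dir, mk2]
  have hd1 : ∀ x : ℝ, (dir x) 1 = Real.sin x := fun x => by simp [dir, mk2]
  have hw := hw0.symm.trans hw0'
  have e0 := congrArg (fun v : Plane => v 0) hw
  have e1 := congrArg (fun v : Plane => v 1) hw
  simp [hd0, hd1] at e0 e1
  refine ⟨J * (2 * Real.pi * Sg) - 10 * Real.pi ^ 2 * Sg,
    (J + 1) * (2 * Real.pi * Sg) + 10 * Real.pi ^ 2 * Sg, ?_, ?_, ?_, ?_⟩
  · have : 0 ≤ Real.pi * Sg := by positivity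
    have : 0 ≤ Real.pi ^ 2 * Sg := by positivity
    linarith
  · have : 0 ≤ (2 * Real.pi + 20 * Real.pi ^ 2) * Sg := by positivity
    calc _ = P.2 * ((2 * Real.pi + 20 * Real.pi ^ 2) * Sg) := by ring
      _ ≤ _ := by nlinarith
  · rintro w ⟨θ, h1, h2, rfl⟩
    obtain ⟨ρ, α, hρ, hα, f0, f1⟩ := core (p.1 0 - P.1 0) (p.1 1 - P.1 1) p.2 θ θ' θ0 (t * P.2)
      (2 * Real.pi * σ) hd hr hr1 (by positivity) (by linarith) (by linarith)
      (abs_le.2 ⟨by linarith, by linarith⟩)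
    have hα' : |α| ≤ 10 * Real.pi ^ 2 * Sg := by
      have : Real.pi ^ 2 * σ ≤ Real.pi ^ 2 * Sg := by gcongr
      linarith
    obtain ⟨hα1, hα2⟩ := abs_le.1 hα'
    refine ⟨P.1 + P.2 • dir (θ0 + α), ⟨θ0 + α, by linarith, by linarith, rfl⟩, ρ / P.2,
      by positivity, ?_⟩
    have hne : P.2 ≠ 0 := by positivity
    rw [add_sub_cancel_left, smul_smul, div_mul_cancel₀ _ hne]
    ext i
    fin_cases i
    · simp [hd0]; linarith
    · simp [hd1]; linarith
  · rintro w ⟨θ, h1, h2, rfl⟩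
    have : 0 ≤ Real.pi ^ 2 * Sg := by positivity
    exact ⟨θ, by linarith, by linarith, rfl⟩

end
end

section
/- Let p, q ∈ 𝐃 be points with |p − q| = t and Δ(p,q) = λ, let δ > 0, and set σ := δ/√((λ + δ)(t + δ)). If v ∈ S(p) ∩ S(q), then for every C ≥ 1 one has C·R^δ_σ(p,v) ⊂ S^{C'δ}(q), where C' ≤ K·max{C, C²δ/(λ + δ)} ≤ K C² for an absolute constant K. -/
open Metric Set

noncomputable section

lemma aux_low (p : Param) (v w : Plane) (hv : v ∈ circ p) (η : ℝ) (h : w ∈ annulus η p) :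
    |‖w - p.1‖ - p.2| ≤ η := by
  refine le_trans ?_ h
  refine (Metric.le_infDist ⟨v, hv⟩).2 ?_
  intro y hy
  have hy' : ‖y - p.1‖ = p.2 := by
    have := Metric.mem_sphere.1 hy
    rwa [dist_eq_norm] at this
  rw [← hy', dist_eq_norm]
  have := abs_norm_sub_norm_le (w - p.1) (y - p.1)
  simpa using this

lemma aux_up (p : Param) (v w : Plane) (hv : v ∈ circ p) (hp : 0 ≤ p.2) :
    Metric.infDist w (circ p) ≤ |‖w - p.1‖ - p.2| := by
  by_cases hw : w = p.1
  · refine (Metric.infDist_le_dist_of_mem hv).trans ?_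
    have := Metric.mem_sphere.1 hv
    rw [hw, dist_comm, this]
    simp [abs_of_nonneg hp]
  · have hn : 0 < ‖w - p.1‖ := norm_pos_iff.2 (sub_ne_zero.2 hw)
    have hm : p.1 + (p.2 / ‖w - p.1‖) • (w - p.1) ∈ circ p := by
      refine Metric.mem_sphere.2 ?_
      rw [dist_eq_norm, add_sub_cancel_left, norm_smul, Real.norm_eq_abs, abs_div, abs_norm,
        abs_of_nonneg hp]
      field_simp
    refine (Metric.infDist_le_dist_of_mem hm).trans ?_
    have e : w - (p.1 + (p.2 / ‖w - p.1‖) • (w - p.1))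
        = (1 - p.2 / ‖w - p.1‖) • (w - p.1) := by
      rw [sub_smul, one_smul]; abel
    rw [dist_eq_norm, e, norm_smul, Real.norm_eq_abs, ← abs_of_pos hn, ← abs_mul, abs_of_pos hn]
    apply le_of_eq
    congr 1
    field_simp

set_option maxHeartbeats 1000000 in
/-- The purely metric core, with `a = v - x`, `b = v - x'`, `u = w - v`. -/
lemma aux_core (a b u : Plane) (r r' t lam δ C M : ℝ) (ha : ‖a‖ = r) (hb : ‖b‖ = r')
    (hr : 1 / 2 ≤ r) (hr1 : r ≤ 1) (hr' : 1 / 2 ≤ r') (hr1' : r' ≤ 1)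
    (hδ : 0 < δ) (hC : 1 ≤ C) (hlam : lam = abs (‖a - b‖ - |r - r'|))
    (ht1 : ‖a - b‖ ≤ t) (ht2 : |r - r'| ≤ t) (hCδ : C * δ ≤ 1)
    (hM : C ≤ M) (hM2 : C ^ 2 * δ ≤ M * (lam + δ))
    (hu : ‖u‖ ^ 2 * ((lam + δ) * (t + δ)) ≤ (C * δ) ^ 2)
    (hw : |‖a + u‖ - r| ≤ C * δ) : |‖b + u‖ - r'| ≤ 100 * M * δ := by
  have hlam0 : 0 ≤ lam := hlam ▸ abs_nonneg _
  have ht0 : 0 ≤ t := (norm_nonneg _).trans ht1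
  have hr0 : 0 < r := by linarith
  have hk2 : r' / r ≤ 2 := by rw [div_le_iff₀ hr0]; linarith
  have hk0 : 0 ≤ r' / r := by positivity
  have hG : 0 < (lam + δ) * (t + δ) := by positivity
  have hCM : C * δ ≤ M * δ := by gcongr
  have hCp : 0 < C * δ := by positivity
  have haa := norm_add_sq_real a u
  have hbb := norm_add_sq_real b u
  have hab := norm_sub_sq_real a b
  set k := r' / r with hk
  have hkr : k * r = r' := by rw [hk]; field_simp
  set e : Plane := b - k • a with he
  have heu : inner ℝ e u = inner ℝ b u - k * inner ℝ a u := by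
    rw [he, inner_sub_left, real_inner_smul_left]
  have hee : ‖e‖ ^ 2 = k * (‖a - b‖ ^ 2 - (r - r') ^ 2) := by
    rw [he, norm_sub_sq_real, norm_smul, real_inner_smul_right, real_inner_comm, hab, ha, hb,
      mul_pow, Real.norm_eq_abs, sq_abs, ← hkr]
    ring
  have hd : ‖a - b‖ ^ 2 - (r - r') ^ 2 ≤ lam * (2 * t) := by
    rw [← sq_abs (r - r')]
    have h1 : ‖a - b‖ - |r - r'| ≤ lam := hlam ▸ le_abs_self _
    have h2 : ‖a - b‖ + |r - r'| ≤ 2 * t := by linarith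
    have h3 : 0 ≤ ‖a - b‖ + |r - r'| := by positivity
    nlinarith [mul_le_mul_of_nonneg_right h1 h3, mul_le_mul_of_nonneg_left h2 hlam0]
  have hee2 : ‖e‖ ^ 2 ≤ 4 * (lam * t) := by
    rw [hee]
    have : 0 ≤ lam * (2 * t) := by positivity
    nlinarith [mul_le_mul_of_nonneg_left hd hk0]
  have hlt : lam * t ≤ (lam + δ) * (t + δ) := by
    nlinarith [mul_pos hδ hδ, mul_nonneg hlam0 hδ.le, mul_nonneg ht0 hδ.le]
  have hE : ‖e‖ * ‖u‖ ≤ 2 * (C * δ) := by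
    refine (pow_le_pow_iff_left₀ (by positivity) (by positivity) two_ne_zero).1 ?_
    calc (‖e‖ * ‖u‖) ^ 2 = ‖e‖ ^ 2 * ‖u‖ ^ 2 := by ring
      _ ≤ (4 * ((lam + δ) * (t + δ))) * ‖u‖ ^ 2 := by gcongr; linarith
      _ ≤ (2 * (C * δ)) ^ 2 := by linarith [hu]
  have hE' : |inner ℝ e u| ≤ 2 * (M * δ) :=
    (abs_real_inner_le_norm e u).trans (hE.trans (by linarith))
  -- third term
  have hT : |1 - k| * ‖u‖ ^ 2 ≤ 2 * (M * δ) := by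
    have h1 : |1 - k| ≤ 2 * t := by
      have : 1 - k = (r - r') / r := by rw [hk]; field_simp
      rw [this, abs_div, abs_of_pos hr0, div_le_iff₀ hr0]
      nlinarith
    have h2 : t * ‖u‖ ^ 2 * (lam + δ) ≤ (M * δ) * (lam + δ) := by
      have h3 : ‖u‖ ^ 2 * ((lam + δ) * t) ≤ ‖u‖ ^ 2 * ((lam + δ) * (t + δ)) := by
        gcongr; linarith
      nlinarith
    have h4 := le_of_mul_le_mul_right h2 (by positivity)
    nlinarith [mul_le_mul_of_nonneg_right h1 (sq_nonneg ‖u‖)]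
  -- first term
  have hF : |‖a + u‖ ^ 2 - r ^ 2| ≤ 3 * (M * δ) := by
    have : ‖a + u‖ ^ 2 - r ^ 2 = (‖a + u‖ - r) * (‖a + u‖ + r) := by ring
    rw [this, abs_mul]
    have h1 : |‖a + u‖ + r| ≤ 3 := by
      rw [abs_of_nonneg (by positivity)]
      have := (abs_le.1 hw).2
      linarith
    calc _ ≤ (C * δ) * 3 := by gcongr
      _ ≤ _ := by linarith
  have hid : ‖b + u‖ ^ 2 - r' ^ 2
      = k * (‖a + u‖ ^ 2 - r ^ 2) + 2 * inner ℝ e u + (1 - k) * ‖u‖ ^ 2 := by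
    rw [haa, hbb, heu, ha, hb]; ring
  have hfin : |‖b + u‖ ^ 2 - r' ^ 2| ≤ 12 * (M * δ) := by
    rw [hid]
    have t1 : |k * (‖a + u‖ ^ 2 - r ^ 2)| ≤ 2 * (3 * (M * δ)) := by
      rw [abs_mul, abs_of_nonneg hk0]; gcongr
    have t2 : |2 * inner ℝ e u| ≤ 2 * (2 * (M * δ)) := by
      rw [abs_mul, abs_two]; gcongr
    have t3 : |(1 - k) * ‖u‖ ^ 2| ≤ 2 * (M * δ) := by
      rw [abs_mul, abs_of_nonneg (sq_nonneg ‖u‖)]; exact hT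
    refine (abs_add_three _ _ _).trans ?_
    linarith
  have hs : |‖b + u‖ - r'| * (‖b + u‖ + r') = |‖b + u‖ ^ 2 - r' ^ 2| := by
    have hp : 0 ≤ ‖b + u‖ + r' := by positivity
    rw [← abs_of_nonneg hp, ← abs_mul]
    congr 1; ring
  have hn := norm_nonneg (b + u)
  have : |‖b + u‖ - r'| * (1 / 2) ≤ |‖b + u‖ - r'| * (‖b + u‖ + r') := by
    gcongr; linarith
  nlinarith

/-- if `v ∈ S(p) ∩ S(q)` with `p, q ∈ 𝐃`, `λ = Δ(p,q)`, `t = |p-q|`,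
`σ = δ/√((λ+δ)(t+δ))`, then `C·R^δ_σ(p,v) ⊆ S^{C'δ}(q)` with
`C' ≲ max{C, C²δ/(λ+δ)} ≤ C²`. -/
theorem rectangle_in_annulus :
    ∃ K > (0 : ℝ),
    ∀ p q : Param, p ∈ domD → q ∈ domD →
    ∀ δ : ℝ, 0 < δ →
    ∀ v : Plane, v ∈ circ p → v ∈ circ q →
    ∀ C : ℝ, 1 ≤ C →
    ∃ C' : ℝ, C' ≤ K * max C (C ^ 2 * δ / (tang p q + δ)) ∧ C' ≤ K * C ^ 2 ∧
      rect (C * δ) (C * (δ / Real.sqrt ((tang p q + δ) * (pdist p q + δ)))) p v ⊆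
        annulus (C' * δ) q := by
  refine ⟨100, by norm_num, ?_⟩
  intro p q hp hq δ hδ v hvp hvq C hC
  have hlam0 : 0 ≤ tang p q := abs_nonneg _
  have hMC : C ≤ max C (C ^ 2 * δ / (tang p q + δ)) := le_max_left _ _
  have hMC2 : C ^ 2 * δ / (tang p q + δ) ≤ max C (C ^ 2 * δ / (tang p q + δ)) := le_max_right _ _
  have hMC3 : max C (C ^ 2 * δ / (tang p q + δ)) ≤ C ^ 2 := by
    refine max_le (by nlinarith) ?_
    rw [div_le_iff₀ (by positivity)]
    gcongr
    linarith
  set M := max C (C ^ 2 * δ / (tang p q + δ)) with hM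
  refine ⟨100 * M, le_rfl, by linarith, ?_⟩
  rintro w ⟨hw, hwv⟩
  obtain ⟨hp1, hp2, hp3⟩ := hp
  obtain ⟨hq1, hq2, hq3⟩ := hq
  refine (aux_up q v w hvq (by linarith)).trans ?_
  have hlow := aux_low p v w hvp _ hw
  have hd : ‖p.1 - q.1‖ ≤ 1 / 2 := (norm_sub_le _ _).trans (by linarith)
  have hCM : C * δ ≤ M * δ := by gcongr
  by_cases hCδ : C * δ ≤ 1
  · have ha : ‖v - p.1‖ = p.2 := by rw [← dist_eq_norm]; exact hvp
    have hb : ‖v - q.1‖ = q.2 := by rw [← dist_eq_norm]; exact hvq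
    have hab : ‖(v - p.1) - (v - q.1)‖ = dist p.1 q.1 := by
      rw [sub_sub_sub_cancel_left, dist_comm, dist_eq_norm]
    have e1 : w - p.1 = (v - p.1) + (w - v) := by abel
    have e2 : w - q.1 = (v - q.1) + (w - v) := by abel
    have hpd0 : 0 ≤ pdist p q := Real.sqrt_nonneg _
    rw [e2]
    rw [e1] at hlow
    refine aux_core (v - p.1) (v - q.1) (w - v) p.2 q.2 (pdist p q) (tang p q) δ C M ha hb
      hp2 hp3 hq2 hq3 hδ hC ?_ ?_ ?_ hCδ hMC ?_ ?_ hlow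
    · rw [hab]; rfl
    · rw [hab]
      exact Real.le_sqrt_of_sq_le (by nlinarith [sq_nonneg (p.2 - q.2)])
    · refine Real.le_sqrt_of_sq_le ?_
      rw [sq_abs]
      nlinarith [sq_nonneg (dist p.1 q.1)]
    · rwa [div_le_iff₀ (by positivity)] at hMC2
    · have hG : 0 < (tang p q + δ) * (pdist p q + δ) := by positivity
      have h1 : ‖w - v‖ ≤ C * (δ / Real.sqrt ((tang p q + δ) * (pdist p q + δ))) := by
        rw [← dist_eq_norm]; exact hwv
      have hs := Real.sqrt_pos.2 hG
      rw [← mul_div_assoc, le_div_iff₀ hs] at h1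
      have h2 : (‖w - v‖ * Real.sqrt ((tang p q + δ) * (pdist p q + δ))) ^ 2 ≤ (C * δ) ^ 2 := by
        gcongr
      rwa [mul_pow, Real.sq_sqrt hG.le] at h2
  · have h1 := abs_le.1 (abs_norm_sub_norm_le (w - q.1) (w - p.1))
    rw [sub_sub_sub_cancel_left] at h1
    have h2 := abs_le.1 hlow
    rw [abs_le]
    constructor <;> linarith [h1.1, h1.2, h2.1, h2.2]

end
end

section
/- Let p, q ∈ 𝐃 be points, let λ := Δ(p,q), t := |p − q|, δ > 0, and set σ := δ/√((λ + δ)(t + δ)). Assume that C·R^δ_σ(p,v) ∩ C·R^δ_σ(q,w) ≠ ∅ for some v ∈ S(p), w ∈ S(q), and C ≥ 1. Then C·R^δ_σ(p,v) ⊂ C'·R^δ_σ(q,w) for some C' ≤ K C⁴, where K is an absolute constant. -/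
open Metric Set

noncomputable section

lemma annulus_abs {q : Param} {w : Plane} (hw : w ∈ circ q) {ε : ℝ} {y : Plane}
    (hy : y ∈ annulus ε q) : |dist y q.1 - q.2| ≤ ε := by
  refine le_trans ?_ hy
  refine (Metric.le_infDist ⟨w, hw⟩).2 ?_
  intro s hs
  have hs' : dist s q.1 = q.2 := hs
  rw [← hs']
  exact abs_dist_sub_le y s q.1

lemma abs_annulus {q : Param} {w : Plane} (hw : w ∈ circ q) (hq : 0 ≤ q.2) {ε : ℝ} {y : Plane}
    (hy : |dist y q.1 - q.2| ≤ ε) : y ∈ annulus ε q := by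
  refine le_trans ?_ hy
  by_cases h : y = q.1
  · subst h
    refine (Metric.infDist_le_dist_of_mem hw).trans ?_
    have hs' : dist w q.1 = q.2 := hw
    rw [dist_comm, hs', dist_self, zero_sub, abs_neg, abs_of_nonneg hq]
  · have hd : 0 < dist y q.1 := dist_pos.2 h
    have hn : ‖y - q.1‖ = dist y q.1 := (dist_eq_norm _ _).symm
    have hs : q.1 + (q.2 / dist y q.1) • (y - q.1) ∈ circ q := by
      show dist _ _ = _
      rw [dist_eq_norm, add_sub_cancel_left, norm_smul, hn, Real.norm_eq_abs,
        abs_of_nonneg (by positivity)]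
      field_simp
    refine (Metric.infDist_le_dist_of_mem hs).trans (le_of_eq ?_)
    have : y - (q.1 + (q.2 / dist y q.1) • (y - q.1))
        = (1 - q.2 / dist y q.1) • (y - q.1) := by
      rw [sub_smul, one_smul]; abel
    rw [dist_eq_norm, this, norm_smul, hn, Real.norm_eq_abs]
    conv_lhs => rw [← abs_of_pos hd, ← abs_mul, abs_of_pos hd]
    congr 1
    field_simp

lemma key_ineq (x x' y z : Plane) :
    dist z x * |dist y x' ^ 2 - dist z x' ^ 2| ≤
      dist z x' * |dist y x ^ 2 - dist z x ^ 2| +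
      2 * dist y z * Real.sqrt (dist z x * dist z x' * (dist x x' ^ 2 - (dist z x - dist z x') ^ 2))
      + dist y z ^ 2 * |dist z x - dist z x'| := by
  obtain ⟨u, hu⟩ : ∃ u, u = z - x := ⟨_, rfl⟩
  obtain ⟨u', hu'⟩ : ∃ u, u = z - x' := ⟨_, rfl⟩
  obtain ⟨h, hh⟩ : ∃ u, u = y - z := ⟨_, rfl⟩
  have e1 : y - x' = h + u' := by rw [hh, hu']; abel
  have e2 : y - x = h + u := by rw [hh, hu]; abel
  have e3 : x - x' = u' - u := by rw [hu, hu']; abel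
  simp only [dist_eq_norm]
  rw [e1, e2, e3, ← hu, ← hu', ← hh]
  have n1 : ‖h + u'‖ ^ 2 - ‖u'‖ ^ 2 = 2 * inner ℝ h u' + ‖h‖ ^ 2 := by
    rw [norm_add_sq_real]; ring
  have n2 : ‖h + u‖ ^ 2 - ‖u‖ ^ 2 = 2 * inner ℝ h u + ‖h‖ ^ 2 := by
    rw [norm_add_sq_real]; ring
  have n3 : ‖u‖ * ‖u'‖ * (‖u' - u‖ ^ 2 - (‖u‖ - ‖u'‖) ^ 2) = ‖(‖u‖ • u' - ‖u'‖ • u)‖ ^ 2 := by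
    rw [norm_sub_sq_real, norm_sub_sq_real, norm_smul, norm_smul, inner_smul_left, inner_smul_right]
    simp
    ring
  rw [n3, Real.sqrt_sq (norm_nonneg _)]
  have n4 : ‖u‖ * (‖h + u'‖ ^ 2 - ‖u'‖ ^ 2) = ‖u'‖ * (‖h + u‖ ^ 2 - ‖u‖ ^ 2)
      + 2 * inner ℝ h (‖u‖ • u' - ‖u'‖ • u) + ‖h‖ ^ 2 * (‖u‖ - ‖u'‖) := by
    rw [n1, n2, inner_sub_right, inner_smul_right, inner_smul_right]; ring
  have c := abs_real_inner_le_norm h (‖u‖ • u' - ‖u'‖ • u)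
  calc ‖u‖ * |‖h + u'‖ ^ 2 - ‖u'‖ ^ 2| = |‖u‖ * (‖h + u'‖ ^ 2 - ‖u'‖ ^ 2)| := by
        rw [abs_mul, abs_of_nonneg (norm_nonneg u)]
    _ ≤ |‖u'‖ * (‖h + u‖ ^ 2 - ‖u‖ ^ 2)| + |2 * inner ℝ h (‖u‖ • u' - ‖u'‖ • u)|
        + |‖h‖ ^ 2 * (‖u‖ - ‖u'‖)| := by rw [n4]; exact abs_add_three _ _ _
    _ ≤ _ := by
        rw [abs_mul, abs_mul, abs_mul, abs_of_nonneg (norm_nonneg u'),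
          abs_of_nonneg (sq_nonneg ‖h‖), abs_of_pos (two_pos : (0:ℝ) < 2)]
        linarith

set_option maxHeartbeats 1000000 in
lemma real_core {a b A B d t lam δ C r r' s σ D : ℝ} (hC : 1 ≤ C) (hδ : 0 < δ)
    (hr : r ∈ Set.Icc (1 / 2 : ℝ) 1) (hr' : r' ∈ Set.Icc (1 / 2 : ℝ) 1)
    (hsm : C * δ ≤ 1 / 4) (ha : |a - r| ≤ C * δ) (hb : |b - r'| ≤ C * δ) (hA : |A - r| ≤ C * δ)
    (hB : 0 ≤ B) (hd : |a - b| ≤ d) (hdt : d ≤ t) (hlam : lam = abs (d - |r - r'|))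
    (hs : s = Real.sqrt ((lam + δ) * (t + δ))) (hσ : σ = δ / s)
    (hD0 : 0 ≤ D) (hD : D ≤ 2 * C * σ)
    (hk : a * |B ^ 2 - b ^ 2| ≤ b * |A ^ 2 - a ^ 2| +
      2 * D * Real.sqrt (a * b * (d ^ 2 - (a - b) ^ 2)) + D ^ 2 * |a - b|) :
    |B - r'| ≤ 1000 * C ^ 4 * δ := by
  have hlam0 : 0 ≤ lam := hlam ▸ abs_nonneg _
  have hd0 : 0 ≤ d := (abs_nonneg _).trans hd
  have ht0 : 0 ≤ t := hd0.trans hdt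
  have hp : 0 < (lam + δ) * (t + δ) := by positivity
  have hs0 : 0 < s := hs ▸ Real.sqrt_pos.2 hp
  have hs2 : s ^ 2 = (lam + δ) * (t + δ) := by rw [hs, Real.sq_sqrt hp.le]
  have hσs : σ * s = δ := by rw [hσ]; field_simp
  have hσ0 : 0 < σ := by rw [hσ]; positivity
  obtain ⟨hr1, hr2⟩ := hr
  obtain ⟨hr1', hr2'⟩ := hr'
  have ha' := abs_le.1 ha
  have hb' := abs_le.1 hb
  have hA' := abs_le.1 hA
  have a1 : 1 / 4 ≤ a := by linarith
  have a2 : a ≤ 5 / 4 := by linarith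
  have b1 : 1 / 4 ≤ b := by linarith
  have b2 : b ≤ 5 / 4 := by linarith
  have A1 : 1 / 4 ≤ A := by linarith
  have A2 : A ≤ 5 / 4 := by linarith
  -- gap
  have g1 : d - |a - b| ≤ lam + 2 * (C * δ) := by
    have h1 : d - |r - r'| ≤ lam := hlam ▸ le_abs_self _
    have h2 : |r - r'| ≤ |a - b| + 2 * (C * δ) := by
      rw [abs_le]
      have := le_abs_self (a - b)
      have := neg_abs_le (a - b)
      constructor <;> linarith
    linarith
  have g2 : d ^ 2 - (a - b) ^ 2 ≤ 4 * C * s ^ 2 := by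
    have h1 : d ^ 2 - (a - b) ^ 2 = (d - |a - b|) * (d + |a - b|) := by
      rw [← sq_abs (a - b)]; ring
    have h2 : lam + 2 * (C * δ) ≤ 2 * C * (lam + δ) := by nlinarith
    have h3 : d + |a - b| ≤ 2 * (t + δ) := by linarith
    rw [h1, hs2]
    calc (d - |a - b|) * (d + |a - b|) ≤ (2 * C * (lam + δ)) * (2 * (t + δ)) := by
          apply mul_le_mul (by linarith) h3 (by positivity) (by positivity)
      _ = _ := by ring
  have g3 : Real.sqrt (a * b * (d ^ 2 - (a - b) ^ 2)) ≤ 4 * C * s := by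
    apply Real.sqrt_le_iff.2 ⟨by positivity, ?_⟩
    have hab : a * b ≤ 4 :=
      (mul_le_mul a2 b2 (by linarith) (by norm_num)).trans (by norm_num)
    have hab0 : 0 ≤ a * b := by positivity
    calc a * b * (d ^ 2 - (a - b) ^ 2) ≤ a * b * (4 * C * s ^ 2) :=
          mul_le_mul_of_nonneg_left g2 hab0
      _ ≤ 4 * (4 * C * s ^ 2) := mul_le_mul_of_nonneg_right hab (by positivity)
      _ = 16 * s ^ 2 * C := by ring
      _ ≤ 16 * s ^ 2 * (C * C) := by
          apply mul_le_mul_of_nonneg_left _ (by positivity)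
          exact le_mul_of_one_le_left (by linarith) hC
      _ = _ := by ring
  have t2 : 2 * D * Real.sqrt (a * b * (d ^ 2 - (a - b) ^ 2)) ≤ 16 * C ^ 2 * δ := by
    calc _ ≤ 2 * (2 * C * σ) * (4 * C * s) := by gcongr
      _ = 16 * C ^ 2 * (σ * s) := by ring
      _ = _ := by rw [hσs]
  have σt : σ ^ 2 * t ≤ δ := by
    have h : σ ^ 2 * s ^ 2 = δ ^ 2 := by rw [← hσs]; ring
    have h1 : δ * t ≤ s ^ 2 := by rw [hs2]; nlinarith [mul_nonneg hlam0 ht0, mul_nonneg hlam0 hδ.le]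
    have h2 : σ ^ 2 * (δ * t) ≤ δ ^ 2 := h ▸ mul_le_mul_of_nonneg_left h1 (sq_nonneg σ)
    have : δ * (σ ^ 2 * t) ≤ δ * δ := by linarith
    exact le_of_mul_le_mul_left this hδ
  have t3 : D ^ 2 * |a - b| ≤ 4 * C ^ 2 * δ := by
    calc D ^ 2 * |a - b| ≤ (2 * C * σ) ^ 2 * t := by
          have := hd.trans hdt
          gcongr
      _ = 4 * C ^ 2 * (σ ^ 2 * t) := by ring
      _ ≤ _ := by gcongr
  have hCδ : C * δ ≤ C ^ 2 * δ := by
    apply mul_le_mul_of_nonneg_right _ hδ.le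
    exact le_self_pow₀ hC (by norm_num)
  have t1 : b * |A ^ 2 - a ^ 2| ≤ 8 * C ^ 2 * δ := by
    have h1 : |A - a| ≤ 2 * (C * δ) := by rw [abs_le]; constructor <;> linarith
    have h2 : |A ^ 2 - a ^ 2| = |A - a| * (A + a) := by
      rw [show A ^ 2 - a ^ 2 = (A - a) * (A + a) by ring, abs_mul,
        abs_of_nonneg (by linarith : 0 ≤ A + a)]
    rw [h2]
    calc b * (|A - a| * (A + a)) ≤ (5/4) * ((2 * (C * δ)) * (5 / 2)) := by
          have : A + a ≤ 5 / 2 := by linarith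
          gcongr
      _ ≤ _ := by linarith [mul_nonneg (by linarith : 0 ≤ C) hδ.le]
  have L : (1 / 16) * |B - b| ≤ a * |B ^ 2 - b ^ 2| := by
    have h2 : |B ^ 2 - b ^ 2| = |B - b| * (B + b) := by
      rw [show B ^ 2 - b ^ 2 = (B - b) * (B + b) by ring, abs_mul,
        abs_of_nonneg (by linarith : 0 ≤ B + b)]
    rw [h2]
    calc (1 / 16) * |B - b| = (1 / 4) * (|B - b| * (1 / 4)) := by ring
      _ ≤ _ := by
        have : 1 / 4 ≤ B + b := by linarith
        gcongr
  have F : |B - b| ≤ 448 * (C ^ 2 * δ) := by linarith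
  have hC4 : C ^ 2 * δ ≤ C ^ 4 * δ := by
    apply mul_le_mul_of_nonneg_right _ hδ.le
    exact pow_le_pow_right₀ hC (by norm_num)
  have : |B - r'| ≤ |B - b| + |b - r'| := abs_sub_le _ _ _
  have : 0 ≤ C ^ 4 * δ := by positivity
  linarith

/-- if `C·R^δ_σ(p,v)` and `C·R^δ_σ(q,w)` intersect, where
`σ = δ/√((λ+δ)(t+δ))` with `λ = Δ(p,q)`, `t = |p-q|`, then
`C·R^δ_σ(p,v) ⊆ C'·R^δ_σ(q,w)` for some `C' ≲ C⁴`. -/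
theorem comparable_of_intersecting :
    ∃ K > (0 : ℝ),
    ∀ p q : Param, p ∈ domD → q ∈ domD →
    ∀ δ : ℝ, 0 < δ →
    ∀ v w : Plane, v ∈ circ p → w ∈ circ q →
    ∀ C : ℝ, 1 ≤ C →
    (rect (C * δ) (C * (δ / Real.sqrt ((tang p q + δ) * (pdist p q + δ)))) p v ∩
      rect (C * δ) (C * (δ / Real.sqrt ((tang p q + δ) * (pdist p q + δ)))) q w).Nonempty →
    ∃ C' : ℝ, C' ≤ K * C ^ 4 ∧
      rect (C * δ) (C * (δ / Real.sqrt ((tang p q + δ) * (pdist p q + δ)))) p v ⊆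
        rect (C' * δ) (C' * (δ / Real.sqrt ((tang p q + δ) * (pdist p q + δ)))) q w := by
  refine ⟨1000, by norm_num, ?_⟩
  intro p q hp hq δ hδ v w hv hw C hC ⟨z, ⟨hz1, hz2⟩, ⟨hz3, hz4⟩⟩
  refine ⟨1000 * C ^ 4, le_rfl, ?_⟩
  obtain ⟨σ, hσ⟩ : ∃ σ, σ = δ / Real.sqrt ((tang p q + δ) * (pdist p q + δ)) := ⟨_, rfl⟩
  rw [← hσ] at hz2 hz4 ⊢
  have hσ0 : 0 ≤ σ := by rw [hσ]; positivity
  have hC4 : C ≤ C ^ 4 := by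
    simpa using pow_le_pow_right₀ hC (by norm_num : 1 ≤ 4)
  have hza := annulus_abs hv hz1
  have hzb := annulus_abs hw hz3
  have hz2' : dist z v ≤ C * σ := hz2
  have hz4' : dist z w ≤ C * σ := hz4
  rintro y ⟨hy1, hy2⟩
  have hya := annulus_abs hv hy1
  have hy2' : dist y v ≤ C * σ := hy2
  have hyz : dist y z ≤ 2 * C * σ := by
    have := dist_triangle_right y z v
    linarith
  obtain ⟨hp1, hp2⟩ := hp
  obtain ⟨hq1, hq2⟩ := hq
  have hq0 : 0 ≤ q.2 := by linarith [hq2.1]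
  constructor
  · apply abs_annulus hw hq0
    by_cases hsm : C * δ ≤ 1 / 4
    · have hd : dist p.1 q.1 ≤ pdist p q := by
        apply Real.le_sqrt_of_sq_le
        nlinarith [sq_nonneg (p.2 - q.2)]
      have hab : |dist z p.1 - dist z q.1| ≤ dist p.1 q.1 := by
        rw [dist_comm z p.1, dist_comm z q.1]; exact abs_dist_sub_le p.1 q.1 z
      exact real_core hC hδ hp2 hq2 hsm hza hzb hya dist_nonneg hab hd rfl rfl hσ dist_nonneg hyz
        (key_ineq p.1 q.1 y z)
    · push Not at hsm
      have h1 : dist p.1 q.1 ≤ 1 / 2 := by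
        have := norm_sub_le p.1 q.1
        rw [dist_eq_norm]; linarith
      have h2 := dist_triangle y p.1 q.1
      have h3 := abs_le.1 hya
      have h4 : C * δ ≤ C ^ 4 * δ := by gcongr
      have h5 : 0 ≤ dist y q.1 := dist_nonneg
      have := hp2.2
      have := hq2.2
      rw [abs_le]
      constructor <;> linarith
  · show dist y w ≤ _
    have h1 := dist_triangle y z w
    have h4 : C * σ ≤ C ^ 4 * σ := by gcongr
    have : 0 ≤ C ^ 4 * σ := by positivity
    linarith

end
end

section
/- Let 0 < δ ≤ σ ≤ 1, and let R₁, R₂ be (δ,σ)-rectangles satisfying R₁ ⊂ C·R₂ for some C ≥ 1. Then C·R₂ ⊂ C'·R₁ for some C' ≤ K C⁵, where K is an absolute constant. -/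
open Metric Set

noncomputable section

lemma aux_dist_sq (w x : Plane) : dist w x ^ 2 = (w 0 - x 0) ^ 2 + (w 1 - x 1) ^ 2 := by
  rw [EuclideanSpace.dist_eq, Real.sq_sqrt (by positivity)]
  simp [Fin.sum_univ_two, Real.dist_eq, sq_abs]

lemma aux_ann_to {δ : ℝ} {p : Param} {w : Plane} (hp : 0 ≤ p.2) (h : w ∈ annulus δ p) :
    |dist w p.1 - p.2| ≤ δ := by
  have hne : (circ p).Nonempty := NormedSpace.sphere_nonempty.2 hp
  obtain ⟨y, hy, hd⟩ := (isCompact_sphere p.1 p.2).exists_infDist_eq_dist hne w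
  have h' : infDist w (circ p) ≤ δ := h
  have hd' : infDist w (circ p) = dist w y := hd
  rw [hd'] at h'
  have hy' : dist y p.1 = p.2 := hy
  have h1 := dist_triangle w y p.1
  have h2 := dist_triangle y w p.1
  rw [dist_comm y w] at h2
  rw [abs_le]; constructor <;> linarith

lemma aux_ann_of {δ : ℝ} {p : Param} {w : Plane} (hp : 0 ≤ p.2)
    (h : |dist w p.1 - p.2| ≤ δ) : w ∈ annulus δ p := by
  change infDist w (circ p) ≤ δ
  by_cases hw : w = p.1
  · obtain ⟨y, hy⟩ : (circ p).Nonempty := NormedSpace.sphere_nonempty.2 hp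
    refine (infDist_le_dist_of_mem hy).trans ?_
    have hy' : dist y p.1 = p.2 := hy
    subst hw
    rw [dist_self, zero_sub, abs_neg, abs_of_nonneg hp] at h
    rw [dist_comm, hy']; exact h
  · have hn : 0 < ‖w - p.1‖ := norm_pos_iff.2 (sub_ne_zero.2 hw)
    have hy : p.1 + (p.2 / ‖w - p.1‖) • (w - p.1) ∈ circ p := by
      change dist _ _ = _
      rw [dist_eq_norm, add_sub_cancel_left, norm_smul, Real.norm_of_nonneg (by positivity)]
      field_simp
    refine (infDist_le_dist_of_mem hy).trans (le_trans (le_of_eq ?_) h)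
    have : w - (p.1 + (p.2 / ‖w - p.1‖) • (w - p.1)) = (1 - p.2 / ‖w - p.1‖) • (w - p.1) := by
      rw [sub_smul, one_smul]; abel
    rw [dist_eq_norm, this, norm_smul, Real.norm_eq_abs, dist_eq_norm]
    nth_rewrite 2 [← abs_of_pos hn]
    rw [← abs_mul]
    congr 1
    field_simp

/-- real core -/
lemma aux_core_s12 (C δ σ r r₂ a b c s m n : ℝ) (hδ : 0 < δ) (hσ : 0 < σ) (hσ1 : σ ≤ 1)
    (hC : 1 ≤ C) (hr : 1 / 2 ≤ r) (hr1 : r ≤ 1) (hr₂ : 1 / 2 ≤ r₂)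
    (hd : a ^ 2 + b ^ 2 ≤ 1 / 4)
    (hs : 0 < s) (hc : c = 1 - σ ^ 2 / 2) (hcs : c ^ 2 + s ^ 2 = 1)
    (hsmall : C * δ ≤ 1 / 100)
    (h0 : |(r - a) ^ 2 + b ^ 2 - r₂ ^ 2| ≤ 5 / 2 * (C * δ))
    (hp : |(r * c - a) ^ 2 + (r * s - b) ^ 2 - r₂ ^ 2| ≤ 5 / 2 * (C * δ))
    (hm : |(r * c - a) ^ 2 + (-(r * s) - b) ^ 2 - r₂ ^ 2| ≤ 5 / 2 * (C * δ))
    (hw : |(m - a) ^ 2 + (n - b) ^ 2 - r₂ ^ 2| ≤ 3 * (C * δ))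
    (hwv : (m - r) ^ 2 + n ^ 2 ≤ (2 * C * σ) ^ 2) :
    |m ^ 2 + n ^ 2 - r ^ 2| ≤ 1500 * C ^ 3 * δ := by
  rw [abs_le] at h0 hp hm hw
  have hCd : 0 < C * δ := by positivity
  have hra : 1 / 10 ≤ r - a := by
    by_contra hcon
    push Not at hcon
    have ha : 2 / 5 ≤ a := by linarith
    have ha2 : a ≤ 1 / 2 := by
      apply le_of_sq_le_sq _ (by norm_num)
      have := sq_nonneg b
      linarith
    have h1 : (2 / 5 : ℝ) ^ 2 ≤ a ^ 2 := by gcongr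
    have h2 : (r - a) ^ 2 ≤ (1 / 10) ^ 2 := by
      have : 0 ≤ r - a := by linarith
      gcongr
    have h3 : (1 / 2 : ℝ) ^ 2 ≤ r₂ ^ 2 := by gcongr
    linarith [h0.1]
  have hs2 : σ ^ 2 / 2 ≤ s ^ 2 := by
    have : s ^ 2 = 1 - c ^ 2 := by linarith
    have h1 : σ ^ 2 ≤ 1 := pow_le_one₀ hσ.le hσ1
    have h2 : σ ^ 2 * σ ^ 2 ≤ σ ^ 2 * 1 := by gcongr
    have h3 : 0 < σ ^ 2 := by positivity
    rw [this, hc]; linarith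
  -- bound on b
  have hb : |b| * s ≤ 5 / 2 * (C * δ) := by
    have h1 : |b * s| * (4 * r) ≤ 5 * (C * δ) := by
      rw [← abs_of_pos (show (0 : ℝ) < 4 * r by linarith), ← abs_mul, abs_le]
      constructor <;> linarith
    rw [abs_mul, abs_of_pos hs] at h1
    have h2 : 0 ≤ |b| * s := by positivity
    have h3 : |b| * s * 2 ≤ |b| * s * (4 * r) := by gcongr; linarith
    linarith
  have hsσ : σ ≤ 3 / 2 * s := by
    apply le_of_sq_le_sq _ (by positivity)
    have := sq_nonneg s
    linarith
  have hb2 : |b| * σ ≤ 15 / 4 * (C * δ) := by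
    have : |b| * σ ≤ |b| * (3 / 2 * s) := by gcongr
    linarith
  have ha : |a| * σ ^ 2 ≤ 10 * (C * δ) := by
    have e1 : a * r * σ ^ 2 = 
      (((r * c - a) ^ 2 + (r * s - b) ^ 2 - r₂ ^ 2) + ((r * c - a) ^ 2 + (-(r * s) - b) ^ 2 - r₂ ^ 2)) / 2
       - ((r - a) ^ 2 + b ^ 2 - r₂ ^ 2) := by
      have : s ^ 2 = 1 - c ^ 2 := by linarith
      have hcc : σ ^ 2 = 2 * (1 - c) := by linarith
      rw [hcc]; linear_combination (-r^2) * this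
    have h1 : |a * r * σ ^ 2| ≤ 5 * (C * δ) := by
      rw [e1, abs_le]; constructor <;> linarith
    rw [abs_mul, abs_mul, abs_of_pos (show 0 < r by linarith), abs_of_pos (show 0 < σ ^ 2 by positivity)] at h1
    have h2 : 0 ≤ |a| * σ ^ 2 := by positivity
    have h3 : |a| * σ ^ 2 * (1 / 2) ≤ |a| * σ ^ 2 * r := by gcongr
    linarith
  have hn : |n| ≤ 2 * C * σ := by
    apply abs_le_of_sq_le_sq _ (by positivity)
    linarith [sq_nonneg (m - r)]
  have hbn : |b * n| ≤ 15 / 2 * C ^ 2 * δ := by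
    rw [abs_mul]
    calc |b| * |n| ≤ |b| * (2 * C * σ) := by gcongr
      _ = (|b| * σ) * (2 * C) := by ring
      _ ≤ (15 / 4 * (C * δ)) * (2 * C) := by gcongr
      _ = _ := by ring
  have haD : |a * ((m - r) ^ 2 + n ^ 2)| ≤ 40 * C ^ 3 * δ := by
    rw [abs_mul, abs_of_nonneg (show 0 ≤ (m - r) ^ 2 + n ^ 2 by positivity)]
    calc |a| * ((m - r) ^ 2 + n ^ 2) ≤ |a| * (2 * C * σ) ^ 2 := by gcongr
      _ = (|a| * σ ^ 2) * (4 * C ^ 2) := by ring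
      _ ≤ (10 * (C * δ)) * (4 * C ^ 2) := by gcongr
      _ = _ := by ring
  have h2 : C ^ 2 * δ ≤ C ^ 3 * δ := by gcongr <;> first | exact hC | norm_num
  have h3 : C * δ ≤ C ^ 3 * δ := by
    gcongr; exact le_self_pow₀ hC (by norm_num)
  have key : (m ^ 2 + n ^ 2 - r ^ 2) * (r - a) =
      r * (((m - a) ^ 2 + (n - b) ^ 2 - r₂ ^ 2) - ((r - a) ^ 2 + b ^ 2 - r₂ ^ 2) + 2 * (b * n))
      - a * ((m - r) ^ 2 + n ^ 2) := by ring
  have hX : |((m - a) ^ 2 + (n - b) ^ 2 - r₂ ^ 2) - ((r - a) ^ 2 + b ^ 2 - r₂ ^ 2) + 2 * (b * n)|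
      ≤ 30 * (C ^ 3 * δ) := by
    rw [abs_le] at hbn ⊢
    constructor <;> linarith
  have hfin : |m ^ 2 + n ^ 2 - r ^ 2| * (r - a) ≤ 70 * (C ^ 3 * δ) := by
    rw [← abs_of_pos (show 0 < r - a by linarith), ← abs_mul,  key]
    refine (abs_sub _ _).trans ?_
    rw [abs_mul r, abs_of_pos (show 0 < r by linarith)]
    have := mul_le_mul hr1 hX (abs_nonneg _) (by norm_num)
    linarith
  have h4 : |m ^ 2 + n ^ 2 - r ^ 2| * (1 / 10) ≤ |m ^ 2 + n ^ 2 - r ^ 2| * (r - a) := by gcongr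
  have : 0 < C ^ 3 * δ := by positivity
  linarith

/-- if `R₁ ⊆ C·R₂` for two `(δ,σ)`-rectangles, then `C·R₂ ⊆ C'·R₁` with
`C' ≲ C⁵`. -/
theorem reverse_inclusion :
    ∃ K > (0 : ℝ),
    ∀ δ σ : ℝ, 0 < δ → δ ≤ σ → σ ≤ 1 →
    ∀ p₁ p₂ : Param, p₁ ∈ domD → p₂ ∈ domD →
    ∀ v₁ v₂ : Plane, v₁ ∈ circ p₁ → v₂ ∈ circ p₂ →
    ∀ C : ℝ, 1 ≤ C →
    rect δ σ p₁ v₁ ⊆ rect (C * δ) (C * σ) p₂ v₂ →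
    ∃ C' : ℝ, C' ≤ K * C ^ 5 ∧ rect (C * δ) (C * σ) p₂ v₂ ⊆ rect (C' * δ) (C' * σ) p₁ v₁ := by
  refine ⟨3000, by norm_num, ?_⟩
  intro δ σ hδ hδσ hσ1 p₁ p₂ hp₁ hp₂ v₁ v₂ hv₁ hv₂ C hC hsub
  obtain ⟨hx1, hr1, hr1'⟩ := hp₁
  obtain ⟨hx2, hr2, hr2'⟩ := hp₂
  have hσ : 0 < σ := hδ.trans_le hδσ
  have hv₁' : dist v₁ p₁.1 = p₁.2 := hv₁
  have hd : dist p₁.1 p₂.1 ≤ 1 / 2 := by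
    rw [dist_eq_norm]; refine (norm_sub_le _ _).trans ?_; linarith
  have hC5 : C ≤ C ^ 5 := le_self_pow₀ hC (by norm_num)
  have hC35 : C ^ 3 ≤ C ^ 5 := pow_le_pow_right₀ hC (by norm_num)
  have hv1R : v₁ ∈ rect (C * δ) (C * σ) p₂ v₂ := by
    apply hsub
    refine ⟨aux_ann_of (by linarith) ?_, mem_closedBall_self hσ.le⟩
    rw [hv₁', sub_self, abs_zero]; exact hδ.le
  refine ⟨3000 * C ^ 5, le_rfl, ?_⟩
  rintro w ⟨hwA, hwB⟩
  have hwB' : dist w v₂ ≤ C * σ := hwB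
  have hvB' : dist v₁ v₂ ≤ C * σ := hv1R.2
  have hwv : dist w v₁ ≤ 2 * C * σ := by
    have := dist_triangle_right w v₁ v₂
    linarith
  have hwA' := aux_ann_to (by linarith) hwA
  refine ⟨aux_ann_of (by linarith) ?_, ?_⟩
  swap
  · change dist w v₁ ≤ _
    refine hwv.trans ?_
    have h1 : C * σ ≤ C ^ 5 * σ := by gcongr
    have h2 : 0 < C * σ := by positivity
    linarith
  have hCδ5 : C * δ ≤ C ^ 5 * δ := by gcongr
  have hCδ35 : C ^ 3 * δ ≤ C ^ 5 * δ := by gcongr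
  rcases lt_or_ge (1 / 100) (C * δ) with hbig | hsmall
  · have h1 := dist_triangle w p₂.1 p₁.1
    rw [dist_comm p₂.1] at h1
    have h2 := dist_nonneg (x := w) (y := p₁.1)
    rw [abs_le] at hwA' ⊢
    constructor <;> linarith
  -- square form
  have hsq : ∀ u : Plane, dist u p₁.1 = p₁.2 → dist u v₁ ≤ σ →
      |dist u p₂.1 ^ 2 - p₂.2 ^ 2| ≤ 5 / 2 * (C * δ) := by
    intro u hu huv
    have hm : u ∈ rect (C * δ) (C * σ) p₂ v₂ := by
      apply hsub
      refine ⟨aux_ann_of (by linarith) ?_, huv⟩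
      rw [hu, sub_self, abs_zero]; exact hδ.le
    have h1 := aux_ann_to (by linarith) hm.1
    have h2 := dist_triangle u p₁.1 p₂.1
    have h3 := dist_nonneg (x := u) (y := p₂.1)
    rw [sq_sub_sq, abs_mul, abs_of_nonneg (by linarith)]
    exact mul_le_mul (by linarith) h1 (abs_nonneg _) (by norm_num)
  have hwsq : |dist w p₂.1 ^ 2 - p₂.2 ^ 2| ≤ 3 * (C * δ) := by
    have h3 := dist_nonneg (x := w) (y := p₂.1)
    have h4 := (abs_le.1 hwA').2
    rw [sq_sub_sq, abs_mul, abs_of_nonneg (by linarith)]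
    exact mul_le_mul (by linarith) hwA' (abs_nonneg _) (by norm_num)
  set r := p₁.2 with hr
  have hrpos : 0 < r := by linarith
  set c := 1 - σ ^ 2 / 2 with hc
  have hσ2 : σ ^ 2 ≤ 1 := pow_le_one₀ hσ.le hσ1
  have hσ2' : 0 < σ ^ 2 := by positivity
  have hc2 : c ^ 2 < 1 := by
    rw [sq_lt_one_iff_abs_lt_one, abs_lt, hc]; constructor <;> linarith
  set s := Real.sqrt (1 - c ^ 2) with hs
  have hspos : 0 < s := Real.sqrt_pos.2 (by linarith)
  have hs2 : s ^ 2 = 1 - c ^ 2 := Real.sq_sqrt (by linarith)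
  obtain ⟨e0, he0⟩ : ∃ e0, v₁ 0 = p₁.1 0 + r * e0 := ⟨(v₁ 0 - p₁.1 0) / r, by field_simp; ring⟩
  obtain ⟨e1, he1⟩ : ∃ e1, v₁ 1 = p₁.1 1 + r * e1 := ⟨(v₁ 1 - p₁.1 1) / r, by field_simp; ring⟩
  have he : e0 ^ 2 + e1 ^ 2 = 1 := by
    have h := aux_dist_sq v₁ p₁.1
    rw [hv₁', he0, he1] at h
    have : r ^ 2 * (e0 ^ 2 + e1 ^ 2) = r ^ 2 * 1 := by linear_combination -h
    exact mul_left_cancel₀ (by positivity) this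
  set d0 := p₂.1 0 - p₁.1 0 with hd0
  set d1 := p₂.1 1 - p₁.1 1 with hd1
  set y0 := w 0 - p₁.1 0 with hy0
  set y1 := w 1 - p₁.1 1 with hy1
  have hpt : ∀ t : ℝ, t ^ 2 = 1 - c ^ 2 →
      |(r * c - (d0 * e0 + d1 * e1)) ^ 2 + (r * t - (d1 * e0 - d0 * e1)) ^ 2 - p₂.2 ^ 2|
        ≤ 5 / 2 * (C * δ) := by
    intro t ht
    have := hsq (mk2 (p₁.1 0 + r * (c * e0 - t * e1)) (p₁.1 1 + r * (c * e1 + t * e0))) ?_ ?_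
    · convert this using 3
      rw [aux_dist_sq]
      simp only [mk2, WithLp.equiv_symm_apply, Matrix.cons_val_zero, Matrix.cons_val_one]
      rw [show p₂.1 0 = p₁.1 0 + d0 by rw [hd0]; ring, show p₂.1 1 = p₁.1 1 + d1 by rw [hd1]; ring]
      linear_combination (-(d0^2 + d1^2)  + r^2 * (c^2 + t^2) * (-1) + (d0^2+d1^2) * 2) * he
    · rw [← sq_eq_sq₀ dist_nonneg hrpos.le, aux_dist_sq]
      simp only [mk2, WithLp.equiv_symm_apply, Matrix.cons_val_zero, Matrix.cons_val_one]
      linear_combination r ^ 2 * (c ^ 2 + t ^ 2) * he + r ^ 2 * ht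
    · apply le_of_sq_le_sq _ hσ.le
      rw [aux_dist_sq, he0, he1]
      simp only [mk2, WithLp.equiv_symm_apply, Matrix.cons_val_zero, Matrix.cons_val_one]
      have : (p₁.1 0 + r * (c * e0 - t * e1) - (p₁.1 0 + r * e0)) ^ 2 +
          (p₁.1 1 + r * (c * e1 + t * e0) - (p₁.1 1 + r * e1)) ^ 2 = r ^ 2 * σ ^ 2 := by
        have hc' : σ ^ 2 = 2 * (1 - c) := by rw [hc]; ring
        rw [hc']
        linear_combination r ^ 2 * ((1 - c) ^ 2 + t ^ 2) * he + r ^ 2 * ht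
      rw [this]
      have : r ^ 2 ≤ 1 := pow_le_one₀ hrpos.le hr1'
      exact mul_le_of_le_one_left hσ2'.le this
  have h0 := hsq v₁ hv₁' (by rw [dist_self]; exact hσ.le)
  have hdsq := aux_dist_sq p₁.1 p₂.1
  have hdd : dist p₁.1 p₂.1 ^ 2 ≤ 1 / 4 := by
    have : dist p₁.1 p₂.1 ^ 2 ≤ (1 / 2) ^ 2 := by gcongr
    linarith
  have hwvsq : dist w v₁ ^ 2 ≤ (2 * C * σ) ^ 2 := by gcongr
  have core := aux_core_s12 C δ σ r p₂.2 (d0 * e0 + d1 * e1) (d1 * e0 - d0 * e1) c s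
    (y0 * e0 + y1 * e1) (y1 * e0 - y0 * e1) hδ hσ hσ1 hC hr1 hr1' hr2
    (by
      have : (d0 * e0 + d1 * e1) ^ 2 + (d1 * e0 - d0 * e1) ^ 2 = dist p₁.1 p₂.1 ^ 2 := by
        rw [hdsq, hd0, hd1]
        linear_combination ((p₂.1 0 - p₁.1 0)^2 + (p₂.1 1 - p₁.1 1)^2) * he
      rw [this]; exact hdd)
    hspos hc (by linarith) hsmall
    (by
      convert h0 using 3
      rw [aux_dist_sq, he0, he1, show p₂.1 0 = p₁.1 0 + d0 by rw [hd0]; ring,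
        show p₂.1 1 = p₁.1 1 + d1 by rw [hd1]; ring]
      linear_combination ((d0^2 + d1^2) - r^2) * he)
    (hpt s hs2)
    (by have := hpt (-s) (by rw [neg_sq]; exact hs2)
        rwa [mul_neg] at this)
    (by
      convert hwsq using 3
      rw [aux_dist_sq, show p₂.1 0 = p₁.1 0 + d0 by rw [hd0]; ring,
        show p₂.1 1 = p₁.1 1 + d1 by rw [hd1]; ring,
        show w 0 = p₁.1 0 + y0 by rw [hy0]; ring, show w 1 = p₁.1 1 + y1 by rw [hy1]; ring]
      linear_combination ((y0 - d0)^2 + (y1 - d1)^2) * he)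
    (by
      have : (y0 * e0 + y1 * e1 - r) ^ 2 + (y1 * e0 - y0 * e1) ^ 2 = dist w v₁ ^ 2 := by
        rw [aux_dist_sq, he0, he1, 
          show w 0 = p₁.1 0 + y0 by rw [hy0]; ring, show w 1 = p₁.1 1 + y1 by rw [hy1]; ring]
        linear_combination (y0^2 + y1^2 - r^2) * he
      rw [this]; exact hwvsq)
  have hQ : (y0 * e0 + y1 * e1) ^ 2 + (y1 * e0 - y0 * e1) ^ 2 = dist w p₁.1 ^ 2 := by
    rw [aux_dist_sq]
    linear_combination (y0^2 + y1^2) * he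
  rw [hQ, sq_sub_sq, abs_mul, abs_of_nonneg (by positivity)] at core
  have h3 := dist_nonneg (x := w) (y := p₁.1)
  have h4 : 1 / 2 * |dist w p₁.1 - r| ≤ (dist w p₁.1 + r) * |dist w p₁.1 - r| := by
    gcongr; linarith
  linarith

end
end

section
/- For every C ≥ 1 there exists C' ≤ K C⁵, with K an absolute constant, such that the following holds: let 0 < δ ≤ σ ≤ 1, and let R₁, R₂, R₃ be (δ,σ)-rectangles such that R₁, R₂ are C-comparable and R₂, R₃ are C-comparable. Then R₁, R₃ are C'-comparable. -/
open Metric Set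

noncomputable section

lemma infDist_circ (p : Param) (hp : 0 ≤ p.2) (w : Plane) :
    Metric.infDist w (circ p) = |dist w p.1 - p.2| := by
  have hne : (circ p).Nonempty := NormedSpace.sphere_nonempty.2 hp
  apply le_antisymm
  · by_cases h : w = p.1
    · obtain ⟨y, hy⟩ := hne
      refine (Metric.infDist_le_dist_of_mem hy).trans ?_
      have hy' : dist y p.1 = p.2 := hy
      rw [h, dist_comm, hy', dist_self, zero_sub, abs_neg]
      exact le_abs_self _
    · have hn : 0 < ‖w - p.1‖ := norm_pos_iff.2 (sub_ne_zero.2 h)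
      have hy : p.1 + (p.2 / ‖w - p.1‖) • (w - p.1) ∈ circ p := by
        simp only [circ, mem_sphere_iff_norm, add_sub_cancel_left, norm_smul, norm_div, norm_norm,
          Real.norm_of_nonneg hp]
        field_simp
      refine (Metric.infDist_le_dist_of_mem hy).trans (le_of_eq ?_)
      have : w - (p.1 + (p.2 / ‖w - p.1‖) • (w - p.1)) = (1 - p.2 / ‖w - p.1‖) • (w - p.1) := by
        rw [sub_smul, one_smul]; abel
      rw [dist_eq_norm, this, norm_smul, dist_eq_norm, Real.norm_eq_abs]
      conv_lhs => rw [← abs_of_pos hn]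
      rw [← abs_mul]
      congr 1
      rw [abs_of_pos hn]
      field_simp
  · rw [Metric.le_infDist hne]
    intro y hy
    have hy' : dist y p.1 = p.2 := hy
    rw [← hy', abs_sub_le_iff]
    constructor
    · linarith [dist_triangle w y p.1]
    · linarith [dist_triangle y w p.1, dist_comm y w]

lemma dsq (a b : Plane) : dist a b ^ 2 = (a 0 - b 0) ^ 2 + (a 1 - b 1) ^ 2 := by
  rw [EuclideanSpace.dist_eq, Real.sq_sqrt (by positivity)]
  simp [Fin.sum_univ_two, Real.dist_eq, sq_abs]

set_option maxHeartbeats 1000000 in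
lemma core_s13 (m n x y d e σ s C E r P l : ℝ) (hσ : 0 < σ) (hs : σ / 2 ≤ s)
    (hC : 1 ≤ C) (hE : 0 ≤ E) (hr : m ^ 2 + n ^ 2 = r ^ 2) (hr1 : 1 / 2 ≤ r) (hr2 : r ≤ 1)
    (hl : |l| ≤ E) (hP : |P| ≤ E)
    (hu : |l + 2 * (x * (-(σ ^ 2 / 2) * m - s * n) + y * (-(σ ^ 2 / 2) * n + s * m))| ≤ E)
    (hv : |l + 2 * (x * (-(σ ^ 2 / 2) * m + s * n) + y * (-(σ ^ 2 / 2) * n - s * m))| ≤ E)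
    (hd : d ^ 2 + e ^ 2 ≤ (2 * C * σ) ^ 2)
    (hco : 12 / 100 ≤ r ^ 2 + (x * m + y * n))
    (hPeq : P = (d ^ 2 + e ^ 2 + 2 * (d * m + e * n)) + l + 2 * (x * d + y * e)) :
    |d ^ 2 + e ^ 2 + 2 * (d * m + e * n)| ≤ 120 * C ^ 2 * E := by
  set α := x * m + y * n with hα
  set β := y * m - x * n with hβ
  set Q := d ^ 2 + e ^ 2 + 2 * (d * m + e * n) with hQ
  set k := e * m - d * n with hk
  have key : (r ^ 2 + α) * Q = r ^ 2 * (P - l) + α * (d ^ 2 + e ^ 2) - 2 * (β * k) := by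
    rw [hPeq, ← hr, hQ, hα, hβ, hk]; ring
  have hu' : |l - σ ^ 2 * α + 2 * s * β| ≤ E := by
    convert hu using 2; rw [hα, hβ]; ring
  have hv' : |l - σ ^ 2 * α - 2 * s * β| ≤ E := by
    convert hv using 2; rw [hα, hβ]; ring
  rw [abs_le] at hl hP hu' hv'
  have hs0 : 0 < s := by linarith
  have h1 : |α| * σ ^ 2 ≤ 2 * E := by
    rw [← abs_of_pos (pow_pos hσ 2), ← abs_mul, abs_le]; constructor <;> linarith
  have h2 : |β| * (2 * s) ≤ E := by
    rw [← abs_of_pos (show 0 < 2 * s by linarith), ← abs_mul, abs_le]; constructor <;> linarith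
  have h2' : |β| * σ ≤ E := le_trans (mul_le_mul_of_nonneg_left (by linarith) (abs_nonneg β)) h2
  have hk2 : |k| ≤ 2 * C * σ := by
    apply abs_le_of_sq_le_sq _ (by positivity)
    have : k ^ 2 ≤ (d ^ 2 + e ^ 2) * r ^ 2 := by
      rw [← hr, hk]; nlinarith [sq_nonneg (d * m + e * n)]
    have : (d ^ 2 + e ^ 2) * r ^ 2 ≤ (d ^ 2 + e ^ 2) * 1 := by
      gcongr; exact pow_le_one₀ (by linarith) hr2
    linarith
  have t1 : |r ^ 2 * (P - l)| ≤ 2 * E := by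
    rw [abs_mul, abs_of_nonneg (sq_nonneg r)]
    have : |P - l| ≤ 2 * E := by rw [abs_le]; constructor <;> linarith
    have hr3 : r ^ 2 ≤ 1 := pow_le_one₀ (by linarith) hr2
    calc r ^ 2 * |P - l| ≤ 1 * |P - l| := by gcongr
      _ ≤ _ := by linarith
  have t2 : |α * (d ^ 2 + e ^ 2)| ≤ 8 * C ^ 2 * E := by
    rw [abs_mul, abs_of_nonneg (show 0 ≤ d ^ 2 + e ^ 2 by positivity)]
    calc |α| * (d ^ 2 + e ^ 2) ≤ |α| * (2 * C * σ) ^ 2 := by gcongr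
      _ = 4 * C ^ 2 * (|α| * σ ^ 2) := by ring
      _ ≤ 4 * C ^ 2 * (2 * E) := by gcongr
      _ = _ := by ring
  have t3 : |2 * (β * k)| ≤ 4 * C * E := by
    rw [abs_mul, abs_mul, abs_two]
    calc 2 * (|β| * |k|) ≤ 2 * (|β| * (2 * C * σ)) := by gcongr
      _ = 4 * C * (|β| * σ) := by ring
      _ ≤ 4 * C * E := by gcongr
  have t4 : (r ^ 2 + α) * |Q| ≤ 2 * E + 8 * C ^ 2 * E + 4 * C * E := by
    rw [← abs_of_pos (show 0 < r ^ 2 + α by linarith), ← abs_mul, key]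
    refine (abs_sub _ _).trans ?_
    linarith [abs_add_le (r ^ 2 * (P - l)) (α * (d ^ 2 + e ^ 2))]
  have t5 : 12 / 100 * |Q| ≤ (r ^ 2 + α) * |Q| := by gcongr
  have c2 : C ≤ C ^ 2 := by nlinarith
  have t6 : C * E ≤ C ^ 2 * E := by gcongr
  have t7 : 1 * E ≤ C ^ 2 * E := by gcongr; linarith
  linarith

lemma mem_rect (δ σ : ℝ) (p : Param) (hp : 0 ≤ p.2) (v w : Plane) :
    w ∈ rect δ σ p v ↔ |dist w p.1 - p.2| ≤ δ ∧ dist w v ≤ σ := by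
  simp only [rect, annulus, mem_inter_iff, mem_ofPred_eq, infDist_circ p hp, mem_closedBall]

set_option maxHeartbeats 1000000 in
lemma half (C δ σ : ℝ) (hC : 1 ≤ C) (hδ : 0 < δ) (hδσ : δ ≤ σ) (hσ1 : σ ≤ 1)
    (r₁ r₂ q : Param × Plane) (h₁ : IsRectData r₁) (h₂ : IsRectData r₂) (hq : IsRectData q)
    (s₁ : rect δ σ r₁.1 r₁.2 ⊆ rect (C * δ) (C * σ) q.1 q.2)
    (s₂ : rect δ σ r₂.1 r₂.2 ⊆ rect (C * δ) (C * σ) q.1 q.2) :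
    rect δ σ r₁.1 r₁.2 ⊆ rect (1000 * C ^ 5 * δ) (1000 * C ^ 5 * σ) r₂.1 r₂.2 := by
  obtain ⟨⟨p₁, a₁⟩, v₁⟩ := r₁
  obtain ⟨⟨p₂, a₂⟩, v₂⟩ := r₂
  obtain ⟨⟨x, r⟩, v⟩ := q
  obtain ⟨⟨hp₁, ha₁, hb₁⟩, hv₁⟩ := h₁
  obtain ⟨⟨hp₂, ha₂, hb₂⟩, hv₂⟩ := h₂
  obtain ⟨⟨hx, hra, hrb⟩, hv⟩ := hq
  simp only [circ, mem_sphere] at *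
  have hσ : 0 < σ := by linarith
  have hCδ : 0 < C * δ := by positivity
  have hC3 : 1 ≤ C ^ 3 := one_le_pow₀ hC
  have hC4 : C ≤ C ^ 5 := by
    calc C = C ^ 1 := by ring
      _ ≤ C ^ 5 := pow_le_pow_right₀ hC (by norm_num)
  have hC35 : C ^ 3 ≤ C ^ 5 := pow_le_pow_right₀ hC (by norm_num)
  intro w hw
  have hw1 := hw
  have hw2 := s₁ hw
  have hvv : v₂ ∈ rect δ σ (p₂, a₂) v₂ := by
    rw [mem_rect _ _ _ (by simp; linarith)]
    simp [hv₂, hδ.le, hσ.le]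
  have hv2 := s₂ hvv
  rw [mem_rect _ _ _ (by simp; linarith)] at hw1 hw2 hv2 ⊢
  simp only at *
  have hdw : dist w v₂ ≤ 2 * C * σ := by
    linarith [dist_triangle w v v₂, dist_comm v v₂]
  refine ⟨?_, ?_⟩
  swap
  · refine hdw.trans ?_
    gcongr
    linarith
  rcases le_or_gt (1 / 100) (C * δ) with hbig | hsm
  · have h10 : 10 ≤ 1000 * C ^ 5 * δ := by nlinarith
    refine le_trans ?_ h10
    have e1 : dist w p₂ ≤ dist w v₁ + dist v₁ p₁ + dist p₁ p₂ := dist_triangle4 _ _ _ _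
    have e2 : dist p₁ p₂ ≤ ‖p₁‖ + ‖p₂‖ := by rw [dist_eq_norm]; exact norm_sub_le _ _
    rw [abs_le]; constructor <;> linarith [dist_nonneg (x := w) (y := p₂)]
  -- squared estimate
  have sqest : ∀ z : Plane, |dist z x - r| ≤ C * δ → |dist z x ^ 2 - r ^ 2| ≤ 3 * (C * δ) := by
    intro z hz
    have : dist z x ^ 2 - r ^ 2 = (dist z x - r) * (dist z x + r) := by ring
    rw [this, abs_mul, abs_of_nonneg (show 0 ≤ dist z x + r by positivity)]
    have h3 : dist z x + r ≤ 3 := by linarith [(abs_le.1 hz).2]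
    calc _ ≤ (C * δ) * 3 := by gcongr
      _ = _ := by ring
  set s := √(σ ^ 2 - σ ^ 4 / 4) with hs
  have hσ2 : σ ^ 2 ≤ 1 := pow_le_one₀ hσ.le hσ1
  have hσ4 : σ ^ 4 ≤ σ ^ 2 := by nlinarith [sq_nonneg σ]
  have hs2 : s ^ 2 = σ ^ 2 - σ ^ 4 / 4 := Real.sq_sqrt (by nlinarith [sq_nonneg σ])
  have hsl : σ / 2 ≤ s := Real.le_sqrt_of_sq_le (by nlinarith [sq_nonneg σ])
  have hMN := dsq v₂ p₂
  rw [hv₂] at hMN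
  have pts : ∀ t : ℝ, t ^ 2 = s ^ 2 →
      |(dist v₂ x ^ 2 - r ^ 2) + 2 * ((p₂ 0 - x 0) * (-(σ ^ 2 / 2) * (v₂ 0 - p₂ 0) - t * (v₂ 1 - p₂ 1))
        + (p₂ 1 - x 1) * (-(σ ^ 2 / 2) * (v₂ 1 - p₂ 1) + t * (v₂ 0 - p₂ 0)))| ≤ 3 * (C * δ) := by
    intro t ht
    set u : Plane := !₂[v₂ 0 + (-(σ ^ 2 / 2) * (v₂ 0 - p₂ 0) - t * (v₂ 1 - p₂ 1)),
      v₂ 1 + (-(σ ^ 2 / 2) * (v₂ 1 - p₂ 1) + t * (v₂ 0 - p₂ 0))] with hu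
    have u0 : u 0 = v₂ 0 + (-(σ ^ 2 / 2) * (v₂ 0 - p₂ 0) - t * (v₂ 1 - p₂ 1)) := by simp [hu]
    have u1 : u 1 = v₂ 1 + (-(σ ^ 2 / 2) * (v₂ 1 - p₂ 1) + t * (v₂ 0 - p₂ 0)) := by simp [hu]
    have d1 : dist u p₂ ^ 2 = a₂ ^ 2 := by
      rw [dsq, u0, u1, hMN]
      linear_combination ((v₂ 0 - p₂ 0) ^ 2 + (v₂ 1 - p₂ 1) ^ 2) * (ht + hs2)
    have d1' : dist u p₂ = a₂ := by
      rwa [sq_eq_sq₀ dist_nonneg (by linarith)] at d1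
    have d2 : dist u v₂ ^ 2 = a₂ ^ 2 * σ ^ 2 := by
      rw [dsq, u0, u1, hMN]
      linear_combination ((v₂ 0 - p₂ 0) ^ 2 + (v₂ 1 - p₂ 1) ^ 2) * (ht + hs2)
    have d2' : dist u v₂ ≤ σ := by
      apply (sq_le_sq₀ dist_nonneg hσ.le).1
      rw [d2]
      have : a₂ ^ 2 ≤ 1 := pow_le_one₀ (by linarith) hb₂
      nlinarith [sq_nonneg σ]
    have hur : u ∈ rect δ σ (p₂, a₂) v₂ := by
      rw [mem_rect _ _ _ (by simp; linarith)]
      exact ⟨by simp [d1', hδ.le], d2'⟩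
    have hu2 := s₂ hur
    rw [mem_rect _ _ _ (by simp; linarith)] at hu2
    have := sqest u hu2.1
    convert this using 2
    have d2'' := d2
    rw [dsq u x, dsq v₂ x, u0, u1]
    rw [dsq, u0, u1, hMN] at d1
    linear_combination -d1
  have A := sqest w hw2.1
  have B := sqest v₂ hv2.1
  have hlow : 49 / 100 ≤ dist v₂ x := by linarith [(abs_le.1 hv2.1).1]
  have hxp : dist p₂ x ≤ 1 / 2 := by
    rw [dist_eq_norm]; linarith [norm_sub_le p₂ x]
  have hco : 12 / 100 ≤ a₂ ^ 2 + ((p₂ 0 - x 0) * (v₂ 0 - p₂ 0) + (p₂ 1 - x 1) * (v₂ 1 - p₂ 1)) := by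
    have f1 : (49 / 100) ^ 2 ≤ dist v₂ x ^ 2 := by gcongr
    have f2 : dist p₂ x ^ 2 ≤ (1 / 2) ^ 2 := by gcongr
    have f3 : (1 / 2) ^ 2 ≤ a₂ ^ 2 := by gcongr
    rw [dsq] at f1 f2
    linarith
  have hd2 : dist w v₂ ^ 2 ≤ (2 * C * σ) ^ 2 := by gcongr
  rw [dsq] at hd2
  have hcore := core_s13 (v₂ 0 - p₂ 0) (v₂ 1 - p₂ 1) (p₂ 0 - x 0) (p₂ 1 - x 1) (w 0 - v₂ 0) (w 1 - v₂ 1)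
    σ s C (3 * (C * δ)) a₂ (dist w x ^ 2 - r ^ 2) (dist v₂ x ^ 2 - r ^ 2) hσ hsl hC (by positivity)
    hMN.symm ha₂ hb₂ B A (pts s rfl)
    (by have := pts (-s) (by ring); convert this using 2; ring) hd2 hco
    (by rw [dsq w x, dsq v₂ x]; ring)
  have hQ : dist w p₂ ^ 2 - a₂ ^ 2 = (w 0 - v₂ 0) ^ 2 + (w 1 - v₂ 1) ^ 2 +
      2 * ((w 0 - v₂ 0) * (v₂ 0 - p₂ 0) + (w 1 - v₂ 1) * (v₂ 1 - p₂ 1)) := by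
    rw [dsq, hMN]; ring
  rw [← hQ, show dist w p₂ ^ 2 - a₂ ^ 2 = (dist w p₂ - a₂) * (dist w p₂ + a₂) by ring, abs_mul,
    abs_of_nonneg (show 0 ≤ dist w p₂ + a₂ by positivity)] at hcore
  have g1 : |dist w p₂ - a₂| * (1 / 2) ≤ |dist w p₂ - a₂| * (dist w p₂ + a₂) := by
    gcongr; linarith [dist_nonneg (x := w) (y := p₂)]
  have g2 : C ^ 3 * δ ≤ C ^ 5 * δ := by gcongr
  have g3 : 120 * C ^ 2 * (3 * (C * δ)) = 360 * (C ^ 3 * δ) := by ring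
  have g4 : 0 ≤ C ^ 5 * δ := by positivity
  linarith

/-- transitivity of comparability: if `R₁,R₂` and `R₂,R₃` are
`C`-comparable `(δ,σ)`-rectangles, then `R₁,R₃` are `C'`-comparable with `C' ≲ C⁵`. -/
theorem comparability_transitive :
    ∃ K > (0 : ℝ),
    ∀ C : ℝ, 1 ≤ C → ∃ C' : ℝ, C' ≤ K * C ^ 5 ∧
    ∀ δ σ : ℝ, 0 < δ → δ ≤ σ → σ ≤ 1 →
    ∀ r₁ r₂ r₃ : Param × Plane, IsRectData r₁ → IsRectData r₂ → IsRectData r₃ →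
      Comp δ σ C r₁ r₂ → Comp δ σ C r₂ r₃ → Comp δ σ C' r₁ r₃ := by
  refine ⟨1000, by norm_num, fun C hC => ⟨1000 * C ^ 5, le_rfl, ?_⟩⟩
  intro δ σ hδ hδσ hσ1 r₁ r₂ r₃ h₁ h₂ h₃ h12 h23
  obtain ⟨q, hq, hs⟩ := h12
  obtain ⟨q', hq', hs'⟩ := h23
  rw [union_subset_iff] at hs hs'
  exact ⟨r₂, h₂, union_subset (half C δ σ hC hδ hδσ hσ1 r₁ r₂ q h₁ h₂ hq hs.1 hs.2)
    (half C δ σ hC hδ hδσ hσ1 r₃ r₂ q' h₃ h₂ hq' hs'.2 hs'.1)⟩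

end
end
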